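/- Let E|k be a field extension inside End_D(V) and let E_D be the unramified intermediate field of E|k of degree gcd(d, f(E|k)) over k. Assume that d/gcd(d, e(E|k)) is coprime to f(E|k). Let Λ and Λ′ be o_D-lattice functions of V each of which is normalized by E^× up to translation (i.e. for every x ∈ E^× there is s ∈ ℝ with x·Λ(t) = Λ(t−s) for all t, and likewise for Λ′). If there exists g ∈ Aut_D(V) with g(Λ(t)) = Λ′(t) for all t ∈ ℝ, then there exists g̃ ∈ Aut_D(V) commuting with every element of E_D such that g̃(Λ(t)) = Λ′(t) for all t ∈ ℝ. -/

import Mathlib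

noncomputable section

/-- Axioms expressing that `ν : K → EReal` is the additive valuation of a
non-Archimedean local (skew) field structure on `K`, normalized relatively to a base
field with valuation group `ℤ`, so that the value group of `K` is `(1/e)ℤ`; `K` is
complete and its residue field has exactly `q` elements (encoded by a complete finite
set of residue representatives). -/
structure IsLocalValuation (K : Type*) [DivisionRing K] (ν : K → EReal) (e q : ℕ) : Prop where
  e_pos : 0 < e
  one_lt_q : 1 < q
  eq_top_iff : ∀ x : K, ν x = ⊤ ↔ x = 0
  map_mul : ∀ x y : K, ν (x * y) = ν x + ν y
  min_le_add : ∀ x y : K, min (ν x) (ν y) ≤ ν (x + y)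
  values : ∀ x : K, x ≠ 0 → ∃ m : ℤ, ν x = ((m / e : ℝ) : EReal)
  exists_uniformizer : ∃ π : K, ν π = (((e : ℝ)⁻¹ : ℝ) : EReal)
  complete : ∀ x : ℕ → K,
      (∀ M : ℝ, ∃ N : ℕ, ∀ m ≥ N, ∀ n ≥ N, (M : EReal) ≤ ν (x m - x n)) →
      ∃ l : K, ∀ M : ℝ, ∃ N : ℕ, ∀ n ≥ N, (M : EReal) ≤ ν (x n - l)
  residue : ∃ s : Finset K, s.card = q ∧ (∀ y ∈ s, 0 ≤ ν y) ∧
      ∀ x : K, 0 ≤ ν x → ∃! y, y ∈ s ∧ 0 < ν (x - y)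

/-- `M` is an `o_D`-lattice in the right `D`-vector space `V`: a finitely generated
`o_D`-submodule (where `o_D = {y | 0 ≤ νD y}`) containing a `D`-basis of `V`. -/
def IsODLattice {D V : Type*} [DivisionRing D] [AddCommGroup V] [Module Dᵐᵒᵖ V]
    (νD : D → EReal) (M : AddSubgroup V) : Prop :=
  (∀ v ∈ M, ∀ y : D, 0 ≤ νD y → MulOpposite.op y • v ∈ M) ∧
  (∃ s : Finset V, ↑s ⊆ (M : Set V) ∧ ∀ v ∈ M,
    v ∈ AddSubgroup.closure
      {w : V | ∃ u ∈ s, ∃ y : D, 0 ≤ νD y ∧ w = MulOpposite.op y • u}) ∧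
  Submodule.span Dᵐᵒᵖ (M : Set V) = ⊤

/-- `Λ` is an `o_D`-lattice function on the right `D`-vector space `V`, where `D` has
index `d`: a decreasing, left-continuous family of `o_D`-lattices with
`Λ(t)·π_D = Λ(t + 1/d)` for every prime element `π_D` of `D`. -/
def IsLatticeFunction {D V : Type*} [DivisionRing D] [AddCommGroup V] [Module Dᵐᵒᵖ V]
    (νD : D → EReal) (d : ℕ) (Λ : ℝ → AddSubgroup V) : Prop :=
  (∀ t : ℝ, IsODLattice νD (Λ t)) ∧
  (∀ s t : ℝ, s ≤ t → Λ t ≤ Λ s) ∧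
  (∀ (t : ℝ) (v : V), v ∈ Λ t ↔ ∀ r : ℝ, r < t → v ∈ Λ r) ∧
  (∀ π : D, νD π = (((d : ℝ)⁻¹ : ℝ) : EReal) →
    ∀ (t : ℝ) (w : V), w ∈ Λ (t + (d : ℝ)⁻¹) ↔ ∃ v ∈ Λ t, w = MulOpposite.op π • v)

section Valuation

/-- A valuation on a division ring with value group `(1/e)ℤ`, not required to be complete or to
have a finite residue ring. -/
structure IsDiscreteVal {F : Type*} [DivisionRing F] (ν : F → EReal) (e : ℕ) : Prop where
  e_pos : 0 < e
  eq_top_iff : ∀ x : F, ν x = ⊤ ↔ x = 0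
  map_mul : ∀ x y : F, ν (x * y) = ν x + ν y
  min_le_add : ∀ x y : F, min (ν x) (ν y) ≤ ν (x + y)
  values : ∀ x : F, x ≠ 0 → ∃ m : ℤ, ν x = ((m / e : ℝ) : EReal)
  exists_uniformizer : ∃ π : F, ν π = (((e : ℝ)⁻¹ : ℝ) : EReal)

/-- Every Cauchy sequence for `ν` converges. -/
def ValComplete {F : Type*} [DivisionRing F] (ν : F → EReal) : Prop :=
  ∀ x : ℕ → F,
    (∀ M : ℝ, ∃ N : ℕ, ∀ m ≥ N, ∀ n ≥ N, (M : EReal) ≤ ν (x m - x n)) →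
    ∃ l : F, ∀ M : ℝ, ∃ N : ℕ, ∀ n ≥ N, (M : EReal) ≤ ν (x n - l)

theorem IsLocalValuation.isDiscreteVal {F : Type*} [DivisionRing F] {ν : F → EReal} {e q : ℕ}
    (h : IsLocalValuation F ν e q) : IsDiscreteVal ν e :=
  ⟨h.e_pos, h.eq_top_iff, h.map_mul, h.min_le_add, h.values, h.exists_uniformizer⟩

namespace IsDiscreteVal

variable {F : Type*} [DivisionRing F] {ν : F → EReal} {e : ℕ}

theorem exists_real (h : IsDiscreteVal ν e) {x : F} (hx : x ≠ 0) : ∃ a : ℝ, ν x = (a : EReal) :=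
  let ⟨_, hm⟩ := h.values x hx
  ⟨_, hm⟩

theorem map_zero (h : IsDiscreteVal ν e) : ν 0 = ⊤ := (h.eq_top_iff 0).2 rfl

theorem map_one (h : IsDiscreteVal ν e) : ν 1 = 0 := by
  obtain ⟨a, ha⟩ := h.exists_real (one_ne_zero (α := F))
  have h1 := h.map_mul 1 1
  rw [mul_one, ha, ← EReal.coe_add, EReal.coe_eq_coe_iff] at h1
  rw [ha, show a = 0 by linarith, EReal.coe_zero]

theorem le_coe_mul (h : IsDiscreteVal ν e) {a b : ℝ} {x y : F} (hx : (a : EReal) ≤ ν x)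
    (hy : (b : EReal) ≤ ν y) : ((a + b : ℝ) : EReal) ≤ ν (x * y) := by
  rw [h.map_mul, EReal.coe_add]
  exact add_le_add hx hy

theorem map_inv (h : IsDiscreteVal ν e) {a : ℝ} {x : F} (hx : ν x = (a : EReal)) :
    ν x⁻¹ = ((-a : ℝ) : EReal) := by
  have hx0 : x ≠ 0 := fun h0 => by
    rw [h0, h.map_zero] at hx
    exact EReal.coe_ne_top a hx.symm
  obtain ⟨b, hb⟩ := h.exists_real (inv_ne_zero hx0)
  have h1 := h.map_mul x x⁻¹
  rw [mul_inv_cancel₀ hx0, h.map_one, hx, hb, ← EReal.coe_add, ← EReal.coe_zero,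
    EReal.coe_eq_coe_iff] at h1
  rw [hb, show b = -a by linarith]

theorem ne_zero_of_eq_coe (h : IsDiscreteVal ν e) {a : ℝ} {x : F} (hx : ν x = (a : EReal)) :
    x ≠ 0 := fun h0 => by
  rw [h0, h.map_zero] at hx
  exact EReal.coe_ne_top a hx.symm

theorem mul_eq_coe (h : IsDiscreteVal ν e) {a b : ℝ} {x y : F} (hx : ν x = (a : EReal))
    (hy : ν y = (b : EReal)) : ν (x * y) = ((a + b : ℝ) : EReal) := by
  rw [h.map_mul, hx, hy, EReal.coe_add]

theorem lt_coe_mul (h : IsDiscreteVal ν e) {a b : ℝ} {x y : F} (hx : (a : EReal) < ν x)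
    (hy : (b : EReal) ≤ ν y) : ((a + b : ℝ) : EReal) < ν (x * y) := by
  by_cases hx0 : x = 0
  · simp [hx0, h.map_zero, EReal.coe_lt_top, -EReal.coe_add]
  by_cases hy0 : y = 0
  · simp [hy0, h.map_zero, EReal.coe_lt_top, -EReal.coe_add]
  obtain ⟨a', ha⟩ := h.exists_real hx0
  obtain ⟨b', hb⟩ := h.exists_real hy0
  rw [ha, EReal.coe_lt_coe_iff] at hx
  rw [hb, EReal.coe_le_coe_iff] at hy
  rw [h.mul_eq_coe ha hb, EReal.coe_lt_coe_iff]
  linarith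

theorem lt_coe_mul' (h : IsDiscreteVal ν e) {a b : ℝ} {x y : F} (hx : (a : EReal) ≤ ν x)
    (hy : (b : EReal) < ν y) : ((a + b : ℝ) : EReal) < ν (x * y) := by
  have := h.lt_coe_mul hy hx
  rwa [h.map_mul, add_comm (ν y), ← h.map_mul, add_comm b] at this

theorem map_neg (h : IsDiscreteVal ν e) (x : F) : ν (-x) = ν x := by
  obtain ⟨a, ha⟩ := h.exists_real (neg_ne_zero.2 (one_ne_zero (α := F)))
  have h1 := h.mul_eq_coe ha ha
  rw [neg_mul_neg, one_mul, h.map_one, ← EReal.coe_zero, EReal.coe_eq_coe_iff] at h1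
  rw [← neg_one_mul, h.map_mul, ha, show a = 0 by linarith, EReal.coe_zero, zero_add]

theorem le_add (h : IsDiscreteVal ν e) {a : EReal} {x y : F} (hx : a ≤ ν x) (hy : a ≤ ν y) :
    a ≤ ν (x + y) := (le_min hx hy).trans (h.min_le_add x y)

theorem lt_add (h : IsDiscreteVal ν e) {a : EReal} {x y : F} (hx : a < ν x) (hy : a < ν y) :
    a < ν (x + y) := (lt_min hx hy).trans_le (h.min_le_add x y)

theorem le_sub (h : IsDiscreteVal ν e) {a : EReal} {x y : F} (hx : a ≤ ν x) (hy : a ≤ ν y) :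
    a ≤ ν (x - y) := sub_eq_add_neg x y ▸ h.le_add hx ((h.map_neg y).symm ▸ hy)

theorem lt_sub (h : IsDiscreteVal ν e) {a : EReal} {x y : F} (hx : a < ν x) (hy : a < ν y) :
    a < ν (x - y) := sub_eq_add_neg x y ▸ h.lt_add hx ((h.map_neg y).symm ▸ hy)

theorem map_sub_comm (h : IsDiscreteVal ν e) (x y : F) : ν (x - y) = ν (y - x) := by
  rw [← h.map_neg, neg_sub]

theorem le_sum (h : IsDiscreteVal ν e) {ι : Type*} {a : EReal} (s : Finset ι) {f : ι → F}
    (hf : ∀ i ∈ s, a ≤ ν (f i)) : a ≤ ν (∑ i ∈ s, f i) := by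
  classical
  induction s using Finset.induction_on with
  | empty => simp [h.map_zero]
  | insert i s hi ih =>
    rw [Finset.sum_insert hi]
    exact h.le_add (hf i (by simp)) (ih fun j hj => hf j (by simp [hj]))

theorem lt_sum (h : IsDiscreteVal ν e) {ι : Type*} {a : ℝ} (s : Finset ι) {f : ι → F}
    (hf : ∀ i ∈ s, (a : EReal) < ν (f i)) : (a : EReal) < ν (∑ i ∈ s, f i) := by
  classical
  induction s using Finset.induction_on with
  | empty => simp [h.map_zero, EReal.coe_lt_top]
  | insert i s hi ih =>
    rw [Finset.sum_insert hi]
    exact h.lt_add (hf i (by simp)) (ih fun j hj => hf j (by simp [hj]))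

theorem mul_nonneg (h : IsDiscreteVal ν e) {x y : F} (hx : 0 ≤ ν x) (hy : 0 ≤ ν y) :
    0 ≤ ν (x * y) := by
  rw [h.map_mul]; exact add_nonneg hx hy

theorem mul_pos_left (h : IsDiscreteVal ν e) {x y : F} (hx : 0 < ν x) (hy : 0 ≤ ν y) :
    0 < ν (x * y) := by
  simpa using h.lt_coe_mul (a := 0) (b := 0) (by simpa using hx) (by simpa using hy)

theorem mul_pos_right (h : IsDiscreteVal ν e) {x y : F} (hx : 0 ≤ ν x) (hy : 0 < ν y) :
    0 < ν (x * y) := by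
  simpa using h.lt_coe_mul' (a := 0) (b := 0) (by simpa using hx) (by simpa using hy)

theorem pow_nonneg (h : IsDiscreteVal ν e) {x : F} (hx : 0 ≤ ν x) (n : ℕ) : 0 ≤ ν (x ^ n) := by
  induction n with
  | zero => simp [h.map_one]
  | succ n ih => rw [pow_succ]; exact h.mul_nonneg ih hx

theorem pow_eq_coe (h : IsDiscreteVal ν e) {a : ℝ} {x : F} (hx : ν x = (a : EReal)) (n : ℕ) :
    ν (x ^ n) = ((n * a : ℝ) : EReal) := by
  induction n with
  | zero => simp [h.map_one]
  | succ n ih =>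
    rw [pow_succ, h.mul_eq_coe ih hx]
    congr 1
    push_cast
    ring

theorem zpow_eq_coe (h : IsDiscreteVal ν e) {a : ℝ} {x : F} (hx : ν x = (a : EReal)) (n : ℤ) :
    ν (x ^ n) = ((n * a : ℝ) : EReal) := by
  cases n with
  | ofNat n => simpa using h.pow_eq_coe hx n
  | negSucc n =>
    rw [zpow_negSucc, h.map_inv (h.pow_eq_coe hx (n + 1))]
    congr 1
    push_cast [Int.negSucc_eq]
    ring

theorem inv_le_of_pos (h : IsDiscreteVal ν e) {x : F} (hx : 0 < ν x) :
    (((e : ℝ)⁻¹ : ℝ) : EReal) ≤ ν x := by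
  by_cases hx0 : x = 0
  · simp [hx0, h.map_zero]
  obtain ⟨m, hm⟩ := h.values x hx0
  have he : (0 : ℝ) < e := by exact_mod_cast h.e_pos
  rw [hm] at hx ⊢
  rw [← EReal.coe_zero, EReal.coe_lt_coe_iff, div_pos_iff_of_pos_right he] at hx
  rw [EReal.coe_le_coe_iff, inv_eq_one_div]
  gcongr
  exact_mod_cast hx

theorem eq_zero_of_forall_le (h : IsDiscreteVal ν e) {x : F}
    (hx : ∀ M : ℝ, (M : EReal) ≤ ν x) : x = 0 := by
  by_contra hx0
  obtain ⟨a, ha⟩ := h.exists_real hx0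
  have := hx (a + 1)
  rw [ha, EReal.coe_le_coe_iff] at this
  linarith

/-- An element congruent to a unit of the valuation ring is a unit. -/
theorem map_eq_zero_of_sub_pos (h : IsDiscreteVal ν e) {x y : F} (hy : ν y = 0)
    (hx : 0 < ν (x - y)) : ν x = 0 := by
  refine le_antisymm (not_lt.1 fun h0 => ?_) ?_
  · have := h.lt_sub h0 hx
    rw [sub_sub_cancel, hy] at this
    exact lt_irrefl _ this
  · have := h.le_add hx.le hy.ge
    rwa [sub_add_cancel] at this

theorem le_pow_sub_pow (h : IsDiscreteVal ν e) {x y : F} (hxy : Commute x y) (hx : 0 ≤ ν x)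
    (hy : 0 ≤ ν y) (n : ℕ) : ν (x - y) ≤ ν (x ^ n - y ^ n) := by
  rw [← hxy.mul_geom_sum₂, h.map_mul]
  exact le_add_of_nonneg_right (h.le_sum _ fun i _ =>
    h.mul_nonneg (h.pow_nonneg hx _) (h.pow_nonneg hy _))

/-- The valuation filtration of a division ring. -/
def fil (h : IsDiscreteVal ν e) (t : ℝ) : AddSubgroup F where
  carrier := {x | (t : EReal) ≤ ν x}
  zero_mem' := by simp [h.map_zero]
  add_mem' := fun ha hb => h.le_add ha hb
  neg_mem' := fun {x} hx => by simpa [h.map_neg] using hx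

theorem mem_fil (h : IsDiscreteVal ν e) {t : ℝ} {x : F} : x ∈ h.fil t ↔ (t : EReal) ≤ ν x :=
  Iff.rfl

end IsDiscreteVal

end Valuation

section Filtration

/-- A decreasing, left-continuous, exhaustive and separated real filtration of a vector space,
compatible with the valuation of the scalars. -/
structure IsNormFiltration {F V : Type*} [DivisionRing F] [AddCommGroup V] [Module F V]
    (ν : F → EReal) (Λ : ℝ → AddSubgroup V) : Prop where
  anti : ∀ s t : ℝ, s ≤ t → Λ t ≤ Λ s
  left_cont : ∀ (t : ℝ) (v : V), (∀ r < t, v ∈ Λ r) → v ∈ Λ t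
  smul_mem : ∀ (a t : ℝ) (c : F) (v : V), (a : EReal) ≤ ν c → v ∈ Λ t → c • v ∈ Λ (t + a)
  exhaust : ∀ v : V, ∃ t : ℝ, v ∈ Λ t
  sep : ∀ v : V, (∀ t : ℝ, v ∈ Λ t) → v = 0

/-- The right limit `Λ(t+) = ⋃_{s > t} Λ(s)` of a filtration. -/
def upper {V : Type*} [AddCommGroup V] (Λ : ℝ → AddSubgroup V) (t : ℝ) : AddSubgroup V :=
  ⨆ s : Set.Ioi t, Λ s

/-- The family `b`, with `b j` placed in degree `τ j`, is independent in the associated graded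
module. -/
def ResIndep {F V ι : Type*} [DivisionRing F] [AddCommGroup V] [Module F V]
    (ν : F → EReal) (Λ : ℝ → AddSubgroup V) (b : ι → V) (τ : ι → ℝ) : Prop :=
  ∀ (t : ℝ) (s : Finset ι) (c : ι → F), (∀ j ∈ s, τ j = t) → (∀ j ∈ s, 0 ≤ ν (c j)) →
    ∑ j ∈ s, c j • b j ∈ upper Λ t → ∀ j ∈ s, 0 < ν (c j)

namespace IsDiscreteVal

theorem isNormFiltration_fil {k W : Type*} [DivisionRing k] [DivisionRing W] [Module k W]
    {νk : k → EReal} {νW : W → EReal} {e : ℕ} (h : IsDiscreteVal νW e)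
    (hc : ∀ (c : k) (w : W), νW (c • w) = νk c + νW w) : IsNormFiltration νk h.fil where
  anti := fun s t hst x hx => (EReal.coe_le_coe_iff.2 hst).trans hx
  left_cont := by
    intro t v hv
    by_cases hv0 : v = 0
    · simp [hv0, h.mem_fil, h.map_zero]
    obtain ⟨a, ha⟩ := h.exists_real hv0
    simp only [h.mem_fil, ha, EReal.coe_le_coe_iff] at hv ⊢
    exact le_of_forall_lt_imp_le_of_dense hv
  smul_mem := by
    intro a t c v hca hv
    rw [h.mem_fil, hc, EReal.coe_add, add_comm]
    exact add_le_add hca hv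
  exhaust := by
    intro v
    by_cases hv0 : v = 0
    · exact ⟨0, by simp [hv0]⟩
    · obtain ⟨a, ha⟩ := h.exists_real hv0
      exact ⟨a, ha.ge⟩
  sep := fun v hv => h.eq_zero_of_forall_le hv

end IsDiscreteVal

namespace IsNormFiltration

variable {F V : Type*} [DivisionRing F] [AddCommGroup V] [Module F V]
  {ν : F → EReal} {e : ℕ} {Λ : ℝ → AddSubgroup V}

theorem mem_upper (hΛ : IsNormFiltration ν Λ) {t : ℝ} {v : V} :
    v ∈ upper Λ t ↔ ∃ s, t < s ∧ v ∈ Λ s := by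
  have : Nonempty (Set.Ioi t) := ⟨⟨t + 1, by simp⟩⟩
  rw [upper, AddSubgroup.mem_iSup_of_directed]
  · simp
  · exact fun a b => ⟨min a b, hΛ.anti _ _ (by exact_mod_cast min_le_left a b),
      hΛ.anti _ _ (by exact_mod_cast min_le_right a b)⟩

theorem le_upper (hΛ : IsNormFiltration ν Λ) {s t : ℝ} (h : t < s) : Λ s ≤ upper Λ t :=
  fun _ hv => hΛ.mem_upper.2 ⟨s, h, hv⟩

theorem smul_upper (hΛ : IsNormFiltration ν Λ) {a t : ℝ} {c : F} {v : V} (hc : (a : EReal) ≤ ν c)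
    (hv : v ∈ upper Λ t) : c • v ∈ upper Λ (t + a) := by
  obtain ⟨s, hs, hv⟩ := hΛ.mem_upper.1 hv
  exact hΛ.mem_upper.2 ⟨s + a, by linarith, hΛ.smul_mem _ _ _ _ hc hv⟩

theorem smul_mem_of_nonneg (hΛ : IsNormFiltration ν Λ) {t : ℝ} {c : F} {v : V} (hc : 0 ≤ ν c)
    (hv : v ∈ Λ t) : c • v ∈ Λ t := by
  simpa using hΛ.smul_mem 0 t c v (by simpa using hc) hv

theorem smul_upper_of_nonneg (hΛ : IsNormFiltration ν Λ) {t : ℝ} {c : F} {v : V} (hc : 0 ≤ ν c)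
    (hv : v ∈ upper Λ t) : c • v ∈ upper Λ t := by
  simpa using hΛ.smul_upper (a := 0) (by simpa using hc) hv

theorem smul_mem_upper (hν : IsDiscreteVal ν e) (hΛ : IsNormFiltration ν Λ) {a t : ℝ} {c : F} {v : V}
    (hc : (a : EReal) < ν c) (hv : v ∈ Λ t) : c • v ∈ upper Λ (t + a) := by
  by_cases hc0 : c = 0
  · simp [hc0]
  obtain ⟨r, hr⟩ := hν.exists_real hc0
  rw [hr, EReal.coe_lt_coe_iff] at hc
  exact hΛ.mem_upper.2 ⟨t + r, by linarith, hΛ.smul_mem _ _ _ _ hr.ge hv⟩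

theorem smul_mem_upper_of_pos (hν : IsDiscreteVal ν e) (hΛ : IsNormFiltration ν Λ) {t : ℝ} {c : F}
    {v : V} (hc : 0 < ν c) (hv : v ∈ Λ t) : c • v ∈ upper Λ t := by
  simpa using smul_mem_upper hν hΛ (a := 0) (by simpa using hc) hv

theorem smul_mem_iff (hν : IsDiscreteVal ν e) (hΛ : IsNormFiltration ν Λ) {a t : ℝ} {c : F}
    (hc : ν c = (a : EReal)) {v : V} : c • v ∈ Λ (t + a) ↔ v ∈ Λ t := by
  refine ⟨fun h => ?_, hΛ.smul_mem _ _ _ _ hc.ge⟩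
  have := hΛ.smul_mem _ _ _ _ (hν.map_inv hc).ge h
  rwa [inv_smul_smul₀ (hν.ne_zero_of_eq_coe hc), add_neg_cancel_right] at this

theorem smul_mem_upper_iff (hν : IsDiscreteVal ν e) (hΛ : IsNormFiltration ν Λ) {a t : ℝ} {c : F}
    (hc : ν c = (a : EReal)) {v : V} : c • v ∈ upper Λ (t + a) ↔ v ∈ upper Λ t := by
  refine ⟨fun h => ?_, hΛ.smul_upper hc.ge⟩
  have := hΛ.smul_upper (hν.map_inv hc).ge h
  rwa [inv_smul_smul₀ (hν.ne_zero_of_eq_coe hc), add_neg_cancel_right] at this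

/-- Every nonzero vector has a well-defined degree. -/
theorem exists_degree (hΛ : IsNormFiltration ν Λ) {v : V} (hv : v ≠ 0) :
    ∃ t, v ∈ Λ t ∧ v ∉ upper Λ t := by
  obtain ⟨T, hT⟩ : ∃ T, v ∉ Λ T := by
    by_contra! h
    exact hv (hΛ.sep v h)
  obtain ⟨t₀, h₀⟩ := hΛ.exhaust v
  have hbdd : BddAbove {t | v ∈ Λ t} :=
    ⟨T, fun t ht => le_of_not_gt fun h => hT (hΛ.anti _ _ h.le ht)⟩
  refine ⟨sSup {t | v ∈ Λ t}, hΛ.left_cont _ _ fun r hr => ?_, fun h => ?_⟩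
  · obtain ⟨t, ht, hrt⟩ := exists_lt_of_lt_csSup ⟨t₀, h₀⟩ hr
    exact hΛ.anti _ _ hrt.le ht
  · obtain ⟨s, hs, hv⟩ := hΛ.mem_upper.1 h
    exact absurd (le_csSup hbdd hv) (not_le.2 hs)

/-- A residually independent family splits the filtration on its span. -/
theorem le_of_sum_mem (hν : IsDiscreteVal ν e) (hΛ : IsNormFiltration ν Λ) {ι : Type*} {b : ι → V}
    {τ : ι → ℝ} (hb : ∀ j, b j ∈ Λ (τ j)) (hind : ResIndep ν Λ b τ)
    (hτ : ∀ (i j : ι) (n : ℤ), τ i = τ j + n / e → τ i = τ j)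
    (s : Finset ι) (c : ι → F) (t : ℝ) (hs : ∑ j ∈ s, c j • b j ∈ Λ t) :
    ∀ j ∈ s, ((t - τ j : ℝ) : EReal) ≤ ν (c j) := by
  classical
  by_contra! hcon
  have hne : ∀ j, ν (c j) < ((t - τ j : ℝ) : EReal) →
      ν (c j) = ((ν (c j)).toReal : EReal) := by
    intro j hj
    have : c j ≠ 0 := fun h0 => by simp [h0, hν.map_zero] at hj
    obtain ⟨a, ha⟩ := hν.exists_real this
    simp [ha]
  obtain ⟨j₀, hj₀, hmin⟩ := Finset.exists_min_image
    (s.filter fun j => ν (c j) < ((t - τ j : ℝ) : EReal)) (fun j => τ j + (ν (c j)).toReal)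
    (by obtain ⟨j, hj, h⟩ := hcon; exact ⟨j, Finset.mem_filter.2 ⟨hj, h⟩⟩)
  rw [Finset.mem_filter] at hj₀
  set a := (ν (c j₀)).toReal with ha
  have hca : ν (c j₀) = (a : EReal) := hne _ hj₀.2
  have hat : a < t - τ j₀ := by
    have := hj₀.2
    rwa [hca, EReal.coe_lt_coe_iff] at this
  have hle : ∀ j ∈ s, ((τ j₀ + a - τ j : ℝ) : EReal) ≤ ν (c j) := by
    intro j hj
    by_cases hjt : ν (c j) < ((t - τ j : ℝ) : EReal)
    · have := hmin j (Finset.mem_filter.2 ⟨hj, hjt⟩)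
      rw [hne j hjt, EReal.coe_le_coe_iff]
      linarith
    · refine le_trans ?_ (not_lt.1 hjt)
      rw [EReal.coe_le_coe_iff]
      linarith
  have hinv := hν.map_inv hca
  set s' := s.filter fun j => ν (c j) = ((τ j₀ + a - τ j : ℝ) : EReal) with hs'
  have hsum : ∑ j ∈ s', ((c j₀)⁻¹ * c j) • b j ∈ upper Λ (τ j₀) := by
    have h1 : (c j₀)⁻¹ • ∑ j ∈ s, c j • b j ∈ upper Λ (τ j₀) :=
      hΛ.le_upper (by linarith) (hΛ.smul_mem _ _ _ _ hinv.ge hs)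
    rw [← Finset.sum_filter_add_sum_filter_not s
      (fun j => ν (c j) = ((τ j₀ + a - τ j : ℝ) : EReal)), smul_add, Finset.smul_sum] at h1
    simp only [smul_smul] at h1
    refine (AddSubgroup.add_mem_cancel_right _ ?_).1 h1
    rw [Finset.smul_sum]
    refine sum_mem fun j hj => ?_
    rw [Finset.mem_filter] at hj
    have h2 := smul_mem_upper hν hΛ (lt_of_le_of_ne (hle j hj.1) (Ne.symm hj.2)) (hb j)
    have h3 := hΛ.smul_upper hinv.ge h2
    rwa [show τ j + (τ j₀ + a - τ j) + -a = τ j₀ by ring] at h3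
  have hτs : ∀ j ∈ s', τ j = τ j₀ ∧ ν ((c j₀)⁻¹ * c j) = 0 := by
    intro j hj
    have hj2 := (Finset.mem_filter.1 hj).2
    have h1 := hν.mul_eq_coe hinv hj2
    obtain ⟨n, hn⟩ := hν.values _ (hν.ne_zero_of_eq_coe h1)
    have h2 : τ j₀ = τ j := by
      refine hτ _ _ n ?_
      rw [hn, EReal.coe_eq_coe_iff] at h1
      linarith
    refine ⟨h2.symm, ?_⟩
    rw [h1, h2, ← EReal.coe_zero, EReal.coe_eq_coe_iff]
    ring
  have hj₀' : j₀ ∈ s' := by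
    rw [hs', Finset.mem_filter, hca]
    exact ⟨hj₀.1, by congr 1; ring⟩
  have := hind (τ j₀) s' _ (fun j hj => (hτs j hj).1) (fun j hj => (hτs j hj).2.ge) hsum j₀ hj₀'
  rw [(hτs j₀ hj₀').2] at this
  exact lt_irrefl _ this

theorem linearIndependent (hν : IsDiscreteVal ν e) (hΛ : IsNormFiltration ν Λ) {ι : Type*} {b : ι → V}
    {τ : ι → ℝ} (hb : ∀ j, b j ∈ Λ (τ j)) (hind : ResIndep ν Λ b τ)
    (hτ : ∀ (i j : ι) (n : ℤ), τ i = τ j + n / e → τ i = τ j) : LinearIndependent F b := by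
  rw [linearIndependent_iff']
  refine fun s c hs j hj => hν.eq_zero_of_forall_le fun M => ?_
  have := le_of_sum_mem hν hΛ hb hind hτ s c (M + τ j) (by rw [hs]; exact zero_mem _) j hj
  rwa [add_sub_cancel_right] at this

end IsNormFiltration

end Filtration

section Splitting

namespace IsNormFiltration

variable {F V : Type*} [DivisionRing F] [AddCommGroup V] [Module F V]
  {ν : F → EReal} {e : ℕ} {Λ : ℝ → AddSubgroup V}

theorem sum_smul_mem (hΛ : IsNormFiltration ν Λ) {ι : Type*} (s : Finset ι) {b : ι → V}
    {τ : ι → ℝ} (hb : ∀ j, b j ∈ Λ (τ j)) {c : ι → F} {t : ℝ}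
    (hc : ∀ j ∈ s, ((t - τ j : ℝ) : EReal) ≤ ν (c j)) : ∑ j ∈ s, c j • b j ∈ Λ t :=
  sum_mem fun j hj => by simpa using hΛ.smul_mem _ _ _ _ (hc j hj) (hb j)

variable {ι : Type*} [Fintype ι] {b : ι → V} {τ : ι → ℝ}

/-- Approximation up to `upper` improves to approximation up to a full period. -/
theorem exists_approx_period (hν : IsDiscreteVal ν e) (hΛ : IsNormFiltration ν Λ)
    (X : Submodule F V) (hbX : ∀ j, b j ∈ X) (T : Finset ℝ)
    (H1 : ∀ t : ℝ, ∀ v ∈ X, v ∈ Λ t → ∃ c : ι → F, (∀ j, ((t - τ j : ℝ) : EReal) ≤ ν (c j)) ∧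
      v - ∑ j, c j • b j ∈ upper Λ t)
    (H2 : ∀ t : ℝ, ∀ v ∈ X, v ∈ Λ t → v ∉ upper Λ t → ∃ r ∈ T, ∃ n : ℤ, t = r + n / e)
    (t : ℝ) (v : V) (hvX : v ∈ X) (hv : v ∈ Λ t) :
    ∃ c : ι → F, (∀ j, ((t - τ j : ℝ) : EReal) ≤ ν (c j)) ∧
      v - ∑ j, c j • b j ∈ Λ (t + (e : ℝ)⁻¹) := by
  classical
  have he : (0 : ℝ) < e := by exact_mod_cast hν.e_pos
  let rep : ℝ → ℝ := fun r => r + ⌈(t - r) * e⌉ / e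
  have hrep : ∀ (r t' : ℝ) (n : ℤ), t' = r + n / e → t ≤ t' → t' < t + (e : ℝ)⁻¹ →
      rep r = t' := by
    intro r t' n hn h1 h2
    have : ⌈(t - r) * e⌉ = n := by
      rw [Int.ceil_eq_iff]
      have h3 : (n : ℝ) = (t' - r) * e := by rw [hn]; field_simp; ring
      rw [h3]
      constructor
      · have : (t' - t) * e < (e : ℝ)⁻¹ * e := by gcongr; linarith
        rw [inv_mul_cancel₀ he.ne'] at this
        linarith
      · gcongr
    simp only [rep, this, hn]
  suffices H : ∀ (N : ℕ) (s : ℝ), t ≤ s → (T.filter fun r => s ≤ rep r).card = N → ∀ u ∈ X,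
      u ∈ Λ s → ∃ c : ι → F, (∀ j, ((t - τ j : ℝ) : EReal) ≤ ν (c j)) ∧
      u - ∑ j, c j • b j ∈ Λ (t + (e : ℝ)⁻¹) from H _ t le_rfl rfl v hvX hv
  intro N
  induction N using Nat.strong_induction_on with
  | _ N ih =>
    intro s hts hN u huX hu
    by_cases huΛ : u ∈ Λ (t + (e : ℝ)⁻¹)
    · exact ⟨0, by simp [hν.map_zero], by simpa⟩
    have hu0 : u ≠ 0 := fun h => huΛ (h ▸ zero_mem _)
    obtain ⟨s', hs', hs'u⟩ := hΛ.exists_degree hu0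
    have hss' : s ≤ s' := le_of_not_gt fun h => hs'u (hΛ.le_upper h hu)
    have hs't : s' < t + (e : ℝ)⁻¹ := lt_of_not_ge fun h => huΛ (hΛ.anti _ _ h hs')
    obtain ⟨r, hr, n, hn⟩ := H2 s' u huX hs' hs'u
    obtain ⟨c, hc, hcu⟩ := H1 s' u huX hs'
    obtain ⟨s'', hs'', hu''⟩ := hΛ.mem_upper.1 hcu
    have hrr : rep r = s' := hrep r s' n hn (hts.trans hss') hs't
    have hlt : (T.filter fun r => s'' ≤ rep r).card < N := by
      rw [← hN]
      refine Finset.card_lt_card (Finset.ssubset_iff_of_subset ?_ |>.2 ⟨r, ?_, ?_⟩)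
      · intro x hx
        rw [Finset.mem_filter] at hx ⊢
        exact ⟨hx.1, by linarith [hx.2]⟩
      · rw [Finset.mem_filter]
        exact ⟨hr, hrr ▸ hss'⟩
      · rw [Finset.mem_filter, hrr]
        exact fun h => absurd h.2 (not_le.2 hs'')
    obtain ⟨c', hc', hcu'⟩ := ih _ hlt s'' (by linarith) rfl _
      (X.sub_mem huX (X.sum_mem fun j _ => X.smul_mem _ (hbX j))) hu''
    refine ⟨c + c', fun j => hν.le_add (le_trans ?_ (hc j)) (hc' j), ?_⟩
    · rw [EReal.coe_le_coe_iff]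
      linarith
    · simpa only [Pi.add_apply, add_smul, Finset.sum_add_distrib, sub_sub] using hcu'

/-- Over a complete division ring, a finite family spanning the associated graded module
spans. -/
theorem exists_repr (hν : IsDiscreteVal ν e) (hcomp : ValComplete ν) (hΛ : IsNormFiltration ν Λ)
    (hb : ∀ j, b j ∈ Λ (τ j)) (X : Submodule F V) (hbX : ∀ j, b j ∈ X) (T : Finset ℝ)
    (H1 : ∀ t : ℝ, ∀ v ∈ X, v ∈ Λ t → ∃ c : ι → F, (∀ j, ((t - τ j : ℝ) : EReal) ≤ ν (c j)) ∧
      v - ∑ j, c j • b j ∈ upper Λ t)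
    (H2 : ∀ t : ℝ, ∀ v ∈ X, v ∈ Λ t → v ∉ upper Λ t → ∃ r ∈ T, ∃ n : ℤ, t = r + n / e)
    (t : ℝ) (v : V) (hvX : v ∈ X) (hv : v ∈ Λ t) :
    ∃ c : ι → F, (∀ j, ((t - τ j : ℝ) : EReal) ≤ ν (c j)) ∧ v = ∑ j, c j • b j := by
  classical
  have he : (0 : ℝ) < e := by exact_mod_cast hν.e_pos
  have hstep := exists_approx_period hν hΛ X hbX T H1 H2
  choose! g hg hgΛ using hstep
  let T' : ℕ → ℝ := fun n => t + n / e
  let w : ℕ → V := fun n => Nat.rec v (fun n u => u - ∑ j, g (T' n) u j • b j) n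
  have hw0 : w 0 = v := rfl
  have hws : ∀ n, w (n + 1) = w n - ∑ j, g (T' n) (w n) j • b j := fun n => rfl
  have hw : ∀ n, w n ∈ X ∧ w n ∈ Λ (T' n) := by
    intro n
    induction n with
    | zero => simp [T', hw0, hvX, hv]
    | succ n ih =>
      rw [hws]
      refine ⟨X.sub_mem ih.1 (X.sum_mem fun j _ => X.smul_mem _ (hbX j)), ?_⟩
      have := hgΛ (T' n) (w n) ih.1 ih.2
      have h2 : T' (n + 1) = T' n + (e : ℝ)⁻¹ := by simp only [T']; push_cast; ring
      rwa [h2]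
  let a : ℕ → ι → F := fun n j => g (T' n) (w n) j
  have ha : ∀ n j, ((T' n - τ j : ℝ) : EReal) ≤ ν (a n j) := fun n j =>
    hg (T' n) (w n) (hw n).1 (hw n).2 j
  let C : ℕ → ι → F := fun n j => ∑ i ∈ Finset.range n, a i j
  have hvC : ∀ n, v - ∑ j, C n j • b j = w n := by
    intro n
    induction n with
    | zero => simp [C, hw0]
    | succ n ih =>
      rw [hws, ← ih, sub_sub, ← Finset.sum_add_distrib]
      congr 1
      refine Finset.sum_congr rfl fun j _ => ?_
      simp only [C, Finset.sum_range_succ, add_smul]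
      rw [ih]
  have hmono : ∀ {m n : ℕ}, m ≤ n → T' m ≤ T' n := fun h => by
    simp only [T']; gcongr
  have hCsub : ∀ {m n : ℕ} (j), m ≤ n → ((T' m - τ j : ℝ) : EReal) ≤ ν (C n j - C m j) := by
    intro m n j hmn
    simp only [C]
    rw [← Finset.sum_Ico_eq_sub _ hmn]
    refine hν.le_sum _ fun i hi => le_trans ?_ (ha i j)
    rw [EReal.coe_le_coe_iff]
    linarith [hmono (Finset.mem_Ico.1 hi).1]
  have hT' : ∀ M : ℝ, ∃ N, M ≤ T' N := by
    intro M
    obtain ⟨N, hN⟩ := exists_nat_ge ((M - t) * e)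
    refine ⟨N, ?_⟩
    have : M - t ≤ N / e := by rwa [le_div_iff₀ he]
    simp only [T']
    linarith
  have hlim : ∀ j, ∃ l : F, ∀ M : ℝ, ∃ N : ℕ, ∀ n ≥ N, (M : EReal) ≤ ν (C n j - l) := by
    intro j
    refine hcomp _ fun M => ?_
    obtain ⟨N, hN⟩ := hT' (M + τ j)
    refine ⟨N, fun m hm n hn => ?_⟩
    have key : ∀ n ≥ N, (M : EReal) ≤ ν (C n j - C N j) := fun n hn => by
      refine le_trans ?_ (hCsub j hn)
      rw [EReal.coe_le_coe_iff]
      linarith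
    have := hν.le_sub (key m hm) (key n hn)
    rwa [sub_sub_sub_cancel_right] at this
  choose l hl using hlim
  refine ⟨l, fun j => ?_, ?_⟩
  · obtain ⟨N, hN⟩ := hl j (t - τ j)
    have h1 := hN N le_rfl
    have h2 : ((t - τ j : ℝ) : EReal) ≤ ν (C N j) := by
      have := hCsub j (Nat.zero_le N)
      simpa [C, T', -EReal.coe_sub] using this
    have := hν.le_sub h2 h1
    rwa [sub_sub_cancel] at this
  · refine sub_eq_zero.1 (hΛ.sep _ fun M => ?_)
    choose N hN using fun j => hl j (M - τ j)
    obtain ⟨N₀, hN₀⟩ := hT' M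
    let n := max N₀ (Finset.univ.sup N)
    have h1 : w n ∈ Λ M := hΛ.anti _ _ (hN₀.trans (hmono (le_max_left _ _))) (hw n).2
    have h2 : ∑ j, (C n j - l j) • b j ∈ Λ M := hΛ.sum_smul_mem _ hb fun j _ =>
      hN j n ((Finset.le_sup (Finset.mem_univ j)).trans (le_max_right _ _))
    have := add_mem h1 h2
    rw [← hvC n] at this
    simpa [sub_smul, Finset.sum_sub_distrib] using this

end IsNormFiltration

end Splitting

section Residual

/-- `S` is a system of representatives of the residue ring. -/
def IsResidueSystem {F : Type*} [DivisionRing F] (ν : F → EReal) (S : Finset F) : Prop :=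
  (∀ y ∈ S, 0 ≤ ν y) ∧ ∀ x : F, 0 ≤ ν x → ∃! y, y ∈ S ∧ 0 < ν (x - y)

theorem IsLocalValuation.exists_residueSystem {F : Type*} [DivisionRing F] {ν : F → EReal}
    {e q : ℕ} (h : IsLocalValuation F ν e q) : ∃ S, IsResidueSystem ν S ∧ S.card = q :=
  let ⟨S, h1, h2, h3⟩ := h.residue
  ⟨S, ⟨h2, h3⟩, h1⟩

/-- Two elements of a residue system which are congruent are equal. -/
theorem IsResidueSystem.eq_of_sub_pos {F : Type*} [DivisionRing F] {ν : F → EReal} {e : ℕ}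
    {S : Finset F} (hν : IsDiscreteVal ν e) (hS : IsResidueSystem ν S) {x y : F} (hx : x ∈ S)
    (hy : y ∈ S) (h : 0 < ν (x - y)) : x = y :=
  (hS.2 x (hS.1 x hx)).unique ⟨hx, by simp [hν.map_zero]⟩ ⟨hy, h⟩

theorem resIndep_const_iff {F V ι : Type*} [DivisionRing F] [AddCommGroup V] [Module F V]
    [Fintype ι] {ν : F → EReal} {e : ℕ} (hν : IsDiscreteVal ν e) {Λ : ℝ → AddSubgroup V}
    {b : ι → V} {t : ℝ} :
    ResIndep ν Λ b (fun _ => t) ↔ ∀ c : ι → F, (∀ j, 0 ≤ ν (c j)) →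
      ∑ j, c j • b j ∈ upper Λ t → ∀ j, 0 < ν (c j) := by
  classical
  refine ⟨fun h c hc hs j => h t Finset.univ c (by simp) (by simpa using hc) hs j (by simp), ?_⟩
  intro h t' s c hst hc hs j hj
  obtain rfl := hst j hj
  have := h (fun j => if j ∈ s then c j else 0) (fun i => by
    by_cases hi : i ∈ s
    · simpa [hi] using hc i hi
    · simp [hi, hν.map_zero]) (by simpa [ite_smul, Finset.sum_ite_mem] using hs) j
  simpa [hj] using this

namespace IsNormFiltration

variable {F V : Type*} [DivisionRing F] [AddCommGroup V] [Module F V]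
  {ν : F → EReal} {e : ℕ} {Λ : ℝ → AddSubgroup V}

/-- A subgroup of a step of the filtration contains a residually independent family generating
its image in the graded piece. -/
theorem exists_residual_basis (hν : IsDiscreteVal ν e) (hΛ : IsNormFiltration ν Λ)
    [Module.Finite F V] (A : AddSubgroup V) (t : ℝ) (hA : A ≤ Λ t) :
    ∃ (n : ℕ) (b : Fin n → V), (∀ j, b j ∈ A) ∧ ResIndep ν Λ b (fun _ => t) ∧
      ∀ v ∈ A, ∃ c : Fin n → F, (∀ j, 0 ≤ ν (c j)) ∧ v - ∑ j, c j • b j ∈ upper Λ t := by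
  classical
  let P : ℕ → Prop := fun n => ∃ b : Fin n → V, (∀ j, b j ∈ A) ∧ ResIndep ν Λ b (fun _ => t)
  have hbound : ∀ n, P n → n ≤ Module.finrank F V := by
    rintro n ⟨b, hb, hind⟩
    simpa using (linearIndependent hν hΛ (fun j => hA (hb j)) hind
      (fun _ _ _ _ => rfl)).fintype_card_le_finrank
  have hP0 : P 0 := ⟨Fin.elim0, fun j => j.elim0, fun _ _ _ _ _ _ j => j.elim0⟩
  obtain ⟨n, hn⟩ : ∃ n, n = Nat.findGreatest P (Module.finrank F V) := ⟨_, rfl⟩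
  obtain ⟨b, hb, hind⟩ : P n :=
    hn ▸ Nat.findGreatest_spec (P := P) (Nat.zero_le (Module.finrank F V)) hP0
  refine ⟨n, b, hb, hind, fun v hv => ?_⟩
  by_contra! hcon
  have hnot : ¬ P (n + 1) := fun h =>
    absurd (Nat.le_findGreatest (hbound _ h) h) (by omega)
  refine hnot ⟨Fin.cons v b, fun j => ?_, ?_⟩
  · refine Fin.cases ?_ (fun i => ?_) j
    · simpa using hv
    · simpa using hb i
  rw [resIndep_const_iff hν] at hind ⊢
  intro c hc hs
  rw [Fin.sum_univ_succ] at hs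
  simp only [Fin.cons_zero, Fin.cons_succ] at hs
  have h0 : 0 < ν (c 0) := by
    by_contra h0
    have h0 : ν (c 0) = ((0 : ℝ) : EReal) := by
      rw [EReal.coe_zero]; exact le_antisymm (not_lt.1 h0) (hc 0)
    have hinv := hν.map_inv h0
    rw [neg_zero, EReal.coe_zero] at hinv
    refine hcon (fun j => -((c 0)⁻¹ * c j.succ)) (fun j => ?_) ?_
    · rw [hν.map_neg]
      exact hν.mul_nonneg hinv.ge (hc _)
    · have := hΛ.smul_upper_of_nonneg hinv.ge hs
      rw [smul_add, inv_smul_smul₀ (hν.ne_zero_of_eq_coe h0), Finset.smul_sum] at this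
      simpa [smul_smul] using this
  refine fun j => Fin.cases h0 (fun j => ?_) j
  exact hind (fun j => c j.succ) (fun j => hc _) ((AddSubgroup.add_mem_cancel_left _
    (smul_mem_upper_of_pos hν hΛ h0 (hA hv))).1 hs) j

/-- The cardinality of a graded piece. -/
theorem relIndex_upper (hν : IsDiscreteVal ν e) (hΛ : IsNormFiltration ν Λ) {S : Finset F}
    (hS : IsResidueSystem ν S) {A : AddSubgroup V} {t : ℝ} (hA : A ≤ Λ t)
    (hAS : ∀ y ∈ S, ∀ v ∈ A, y • v ∈ A) {ι : Type*} [Fintype ι] {b : ι → V} (hb : ∀ j, b j ∈ A)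
    (hind : ResIndep ν Λ b (fun _ => t))
    (hspan : ∀ v ∈ A, ∃ c : ι → F, (∀ j, 0 ≤ ν (c j)) ∧ v - ∑ j, c j • b j ∈ upper Λ t) :
    (upper Λ t).relIndex A = S.card ^ Fintype.card ι := by
  classical
  rw [resIndep_const_iff hν] at hind
  let φ : (ι → S) → A ⧸ (upper Λ t).addSubgroupOf A := fun y =>
    QuotientAddGroup.mk (⟨∑ j, (y j : F) • b j,
      sum_mem fun j _ => hAS _ (y j).2 _ (hb j)⟩ : A)
  have hφ : Function.Bijective φ := by
    constructor
    · intro y y' h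
      simp only [φ] at h
      rw [QuotientAddGroup.eq, AddSubgroup.mem_addSubgroupOf] at h
      have h2 : ∑ j, ((y' j : F) - (y j : F)) • b j ∈ upper Λ t := by
        simp only [sub_smul, Finset.sum_sub_distrib]
        rw [← neg_add_eq_sub]
        exact h
      have := hind _ (fun j => hν.le_sub (hS.1 _ (y' j).2) (hS.1 _ (y j).2)) h2
      funext j
      exact Subtype.ext (hS.eq_of_sub_pos hν (y' j).2 (y j).2 (this j)).symm
    · intro x
      obtain ⟨⟨v, hv⟩, rfl⟩ := QuotientAddGroup.mk_surjective x
      obtain ⟨c, hc, hcv⟩ := hspan v hv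
      choose y hy using fun j => (hS.2 (c j) (hc j)).exists
      refine ⟨fun j => ⟨y j, (hy j).1⟩, ?_⟩
      simp only [φ]
      rw [QuotientAddGroup.eq, AddSubgroup.mem_addSubgroupOf]
      have h3 : ∑ j, (c j - y j) • b j ∈ upper Λ t :=
        sum_mem fun j _ => smul_mem_upper_of_pos hν hΛ (hy j).2 (hA (hb j))
      have h4 := add_mem hcv h3
      simp only [sub_smul, Finset.sum_sub_distrib] at h4
      simpa [neg_add_eq_sub] using h4
  rw [AddSubgroup.relIndex, AddSubgroup.index, ← Nat.card_eq_of_bijective φ hφ]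
  simp

end IsNormFiltration

end Residual

section GradedBasis

namespace IsNormFiltration

variable {F V : Type*} [DivisionRing F] [AddCommGroup V] [Module F V]
  {ν : F → EReal} {e : ℕ} {Λ : ℝ → AddSubgroup V}
  {T : Finset ℝ} {ι : T → Type*} [∀ r, Fintype (ι r)] {b : ∀ r, ι r → V}

theorem resIndep_sigma (hind : ∀ r : T, ResIndep ν Λ (b r) (fun _ => (r : ℝ))) :
    ResIndep ν Λ (fun p : Σ r, ι r => b p.1 p.2) (fun p => (p.1 : ℝ)) := by
  classical
  rintro t s c hs hc hsum ⟨r, j⟩ hj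
  have hst : s = (Finset.univ.filter fun i : ι r => (⟨r, i⟩ : Σ r, ι r) ∈ s).map
      ⟨Sigma.mk r, sigma_mk_injective⟩ := by
    ext ⟨r', i⟩
    simp only [Finset.mem_map, Finset.mem_filter, Finset.mem_univ, true_and,
      Function.Embedding.coeFn_mk]
    constructor
    · intro h
      have : r' = r := Subtype.ext ((hs _ h).trans (hs _ hj).symm)
      subst this
      exact ⟨i, h, rfl⟩
    · rintro ⟨a, ha, h⟩
      rwa [← h]
  rw [hst, Finset.sum_map] at hsum
  refine hind r t _ (fun i => c ⟨r, i⟩) (fun i _ => hs _ hj) (fun i hi => hc _ ?_) hsum j ?_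
  · simpa using hi
  · simpa using hj

/-- A family which, in each degree of a system of representatives of the degrees modulo the value
group, is a residual basis, splits the filtration. -/
theorem sum_sigma_mem_iff (hν : IsDiscreteVal ν e) (hΛ : IsNormFiltration ν Λ)
    (hb : ∀ (r : T) j, b r j ∈ Λ r)
    (hind : ∀ r : T, ResIndep ν Λ (b r) (fun _ => (r : ℝ)))
    (hT : ∀ (r s : T) (n : ℤ), (r : ℝ) = s + n / e → r = s) (c : (Σ r, ι r) → F) (t : ℝ) :
    ∑ p, c p • b p.1 p.2 ∈ Λ t ↔ ∀ p, ((t - p.1 : ℝ) : EReal) ≤ ν (c p) := by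
  constructor
  · intro h p
    exact le_of_sum_mem hν hΛ (b := fun p : Σ r, ι r => b p.1 p.2) (τ := fun p => (p.1 : ℝ))
      (fun p => hb _ _) (resIndep_sigma hind)
      (fun _ _ n hij => congrArg Subtype.val (hT _ _ n hij)) _ _ _ h p (Finset.mem_univ _)
  · intro h
    exact hΛ.sum_smul_mem _ (b := fun p : Σ r, ι r => b p.1 p.2) (τ := fun p => (p.1 : ℝ))
      (fun p => hb _ _) fun p _ => h p

theorem linearIndependent_sigma (hν : IsDiscreteVal ν e) (hΛ : IsNormFiltration ν Λ)
    (hb : ∀ (r : T) j, b r j ∈ Λ r)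
    (hind : ∀ r : T, ResIndep ν Λ (b r) (fun _ => (r : ℝ)))
    (hT : ∀ (r s : T) (n : ℤ), (r : ℝ) = s + n / e → r = s) :
    LinearIndependent F (fun p : Σ r, ι r => b p.1 p.2) :=
  linearIndependent hν hΛ (τ := fun p => (p.1 : ℝ)) (fun _ => hb _ _) (resIndep_sigma hind)
    (fun _ _ n hij => congrArg Subtype.val (hT _ _ n hij))

theorem exists_repr_sigma (hν : IsDiscreteVal ν e) (hcomp : ValComplete ν)
    (hΛ : IsNormFiltration ν Λ) (hb : ∀ (r : T) j, b r j ∈ Λ r) (X : Submodule F V)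
    (hbX : ∀ r j, b r j ∈ X)
    (hspan : ∀ r : T, ∀ v ∈ X, v ∈ Λ r → ∃ c : ι r → F, (∀ j, 0 ≤ ν (c j)) ∧
      v - ∑ j, c j • b r j ∈ upper Λ r)
    (H2 : ∀ t : ℝ, ∀ v ∈ X, v ∈ Λ t → v ∉ upper Λ t → ∃ r ∈ T, ∃ n : ℤ, t = r + n / e)
    {t : ℝ} {v : V} (hvX : v ∈ X) (hv : v ∈ Λ t) :
    ∃ c : (Σ r, ι r) → F, (∀ p, ((t - p.1 : ℝ) : EReal) ≤ ν (c p)) ∧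
      v = ∑ p, c p • b p.1 p.2 := by
  classical
  refine exists_repr hν hcomp hΛ (b := fun p : Σ r, ι r => b p.1 p.2) (τ := fun p => (p.1 : ℝ))
    (fun p => hb _ _) X (fun p => hbX _ _) T (fun t v hvX hv => ?_) H2 t v hvX hv
  by_cases hvu : v ∈ upper Λ t
  · exact ⟨0, by simp [hν.map_zero], by simpa⟩
  obtain ⟨r, hr, n, hn⟩ := H2 t v hvX hv hvu
  obtain ⟨π, hπ⟩ := hν.exists_uniformizer
  have hπn := hν.zpow_eq_coe hπ n
  rw [← div_eq_mul_inv] at hπn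
  have hπn' := hν.map_inv hπn
  obtain ⟨c, hc, hcv⟩ := hspan ⟨r, hr⟩ _ (X.smul_mem (π ^ n)⁻¹ hvX) (by
    simpa [hn] using hΛ.smul_mem _ _ _ _ hπn'.ge hv)
  let c' : ∀ r, ι r → F := Pi.single ⟨r, hr⟩ fun j => π ^ n * c j
  refine ⟨fun p => c' p.1 p.2, fun ⟨r', j⟩ => ?_, ?_⟩
  · by_cases h : r' = ⟨r, hr⟩
    · subst h
      simp only [c', Pi.single_eq_same]
      have := hν.le_coe_mul (b := 0) hπn.ge (by simpa using hc j)
      rwa [add_zero, show (n : ℝ) / e = t - r by linarith] at this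
    · simp [c', Pi.single_eq_of_ne h, hν.map_zero]
  · have h1 : ∑ p : (Σ r, ι r), c' p.1 p.2 • b p.1 p.2
        = π ^ n • ∑ j, c j • b ⟨r, hr⟩ j := by
      rw [Fintype.sum_sigma, Finset.sum_eq_single ⟨r, hr⟩]
      · simp [c', mul_smul, Finset.smul_sum]
      · intro r' _ h
        simp [c', Pi.single_eq_of_ne h]
      · simp
    have h2 := hΛ.smul_upper hπn.ge hcv
    rw [smul_sub, smul_inv_smul₀ (hν.ne_zero_of_eq_coe hπn), ← h1] at h2
    rwa [hn]

end IsNormFiltration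

end GradedBasis

section FundamentalIdentity

theorem IsDiscreteVal.mem_upper_fil {W : Type*} [DivisionRing W] {ν : W → EReal} {e : ℕ}
    (h : IsDiscreteVal ν e) {t : ℝ} {x : W} : x ∈ upper h.fil t ↔ (t : EReal) < ν x := by
  have hf : IsNormFiltration ν h.fil := h.isNormFiltration_fil fun c w => h.map_mul c w
  rw [hf.mem_upper]
  constructor
  · rintro ⟨s, hs, hx⟩
    exact (EReal.coe_lt_coe_iff.2 hs).trans_le hx
  · intro hx
    obtain ⟨s, hs, hsx⟩ := EReal.lt_iff_exists_real_btwn.1 hx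
    exact ⟨s, EReal.coe_lt_coe_iff.1 hs, hsx.le⟩

theorem IsDiscreteVal.exists_degree_eq {W : Type*} [DivisionRing W] {ν : W → EReal} {e : ℕ}
    (h : IsDiscreteVal ν e) {t : ℝ} {x : W} (hx : x ∈ h.fil t) (hx' : x ∉ upper h.fil t) :
    ∃ m : ℤ, t = m / e ∧ ν x = (t : EReal) := by
  have h1 : ν x = (t : EReal) := le_antisymm (not_lt.1 fun h2 => hx' (h.mem_upper_fil.2 h2)) hx
  obtain ⟨m, hm⟩ := h.values x (h.ne_zero_of_eq_coe h1)
  exact ⟨m, EReal.coe_eq_coe_iff.1 (h1.symm.trans hm), h1⟩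

/-- Representatives of `(1/e)ℤ` modulo `ℤ`. -/
def degreeReps (e : ℕ) : Finset ℝ := (Finset.range e).image fun i : ℕ => (i / e : ℝ)

theorem exists_mem_degreeReps {e : ℕ} (he : 0 < e) (m : ℤ) :
    ∃ r ∈ degreeReps e, ∃ n : ℤ, (m / e : ℝ) = r + n / ((1 : ℕ) : ℝ) := by
  have he₀ : (0 : ℝ) < e := by exact_mod_cast he
  have he' : (0 : ℤ) < e := by exact_mod_cast he
  refine ⟨((m % e).toNat : ℝ) / e, Finset.mem_image.2 ⟨(m % e).toNat, ?_, rfl⟩, m / e, ?_⟩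
  · have := Int.emod_lt_of_pos m he'
    have := Int.emod_nonneg m he'.ne'
    rw [Finset.mem_range]
    omega
  · have h1 : ((m % e).toNat : ℝ) = ((m % e : ℤ) : ℝ) := by
      exact_mod_cast Int.toNat_of_nonneg (Int.emod_nonneg m he'.ne')
    have h2 : (m : ℝ) = ((m % e : ℤ) : ℝ) + e * ((m / e : ℤ) : ℝ) := by
      exact_mod_cast (Int.emod_add_mul_ediv m e).symm
    rw [h1, h2, Nat.cast_one, div_one]
    field_simp

/-- The fundamental identity `[W : k] = e f` for a discretely valued division algebra over a
local field. -/
theorem exists_relIndex_fil_eq {k W : Type*} [Field k] [DivisionRing W] [Algebra k W]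
    [Module.Finite k W] {νk : k → EReal} {νW : W → EReal} {q e : ℕ}
    (hk : IsLocalValuation k νk 1 q) (hW : IsDiscreteVal νW e)
    (hcompat : ∀ c : k, νW (algebraMap k W c) = νk c) :
    ∃ n, (upper hW.fil 0).relIndex (hW.fil 0) = q ^ n ∧ Module.finrank k W = e * n := by
  classical
  have hν := hk.isDiscreteVal
  have he : (0 : ℝ) < e := by exact_mod_cast hW.e_pos
  have hsm : ∀ (c : k) (w : W), νW (c • w) = νk c + νW w := fun c w => by
    rw [Algebra.smul_def, hW.map_mul, hcompat]
  have hΛ : IsNormFiltration νk hW.fil := hW.isNormFiltration_fil hsm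
  obtain ⟨n, b, hb, hind, hspan⟩ := hΛ.exists_residual_basis hν (hW.fil 0) 0 le_rfl
  obtain ⟨S, hS, hSq⟩ := hk.exists_residueSystem
  refine ⟨n, ?_, ?_⟩
  · rw [hΛ.relIndex_upper hν hS le_rfl (fun y hy v hv => hΛ.smul_mem_of_nonneg (hS.1 y hy) hv)
      hb hind hspan, hSq, Fintype.card_fin]
  obtain ⟨π, hπ⟩ := hW.exists_uniformizer
  have hπn : ∀ i : ℕ, νW (π ^ i) = ((i / e : ℝ) : EReal) := fun i => by
    rw [hW.pow_eq_coe hπ, div_eq_mul_inv]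
  let T : Finset ℝ := degreeReps e
  have hTi : ∀ r : T, ∃ i : ℕ, i < e ∧ (r : ℝ) = i / e := fun ⟨r, hr⟩ => by
    obtain ⟨i, hi, rfl⟩ := Finset.mem_image.1 hr
    exact ⟨i, Finset.mem_range.1 hi, rfl⟩
  choose i hie hi using hTi
  have hTcard : T.card = e := by
    refine (Finset.card_image_of_injective _ ?_).trans (Finset.card_range e)
    intro a b hab
    have := (div_left_inj' he.ne').1 hab
    exact_mod_cast this
  let B : ∀ _ : T, Fin n → W := fun r j => b j * π ^ i r
  have hmul : ∀ (r : T) (t : ℝ) (x : W), ((t : ℝ) : EReal) ≤ νW x →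
      ((t + r : ℝ) : EReal) ≤ νW (x * π ^ i r) := fun r t x hx =>
    hW.le_coe_mul hx (by rw [hπn, hi])
  have hinv : ∀ r : T, νW (π ^ i r)⁻¹ = ((-(r : ℝ) : ℝ) : EReal) := fun r => by
    rw [hW.map_inv (hπn _), hi]
  have hne : ∀ r : T, π ^ i r ≠ 0 := fun r => hW.ne_zero_of_eq_coe (hπn _)
  have hBsum : ∀ (r : T) (c : Fin n → k), ∑ j, c j • B r j = (∑ j, c j • b j) * π ^ i r :=
    fun r c => by simp [B, Finset.sum_mul]
  have hB : ∀ (r : T) j, B r j ∈ hW.fil r := fun r j => by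
    have := hmul r 0 (b j) (hb j)
    rwa [zero_add] at this
  have hBind : ∀ r : T, ResIndep νk hW.fil (B r) (fun _ => (r : ℝ)) := by
    intro r
    rw [resIndep_const_iff hν] at hind ⊢
    intro c hc hsum
    refine hind c hc ?_
    rw [hBsum, hW.mem_upper_fil] at hsum
    have := hW.lt_coe_mul hsum (hinv r).ge
    rw [mul_inv_cancel_right₀ (hne r), add_neg_cancel] at this
    exact hW.mem_upper_fil.2 this
  have hT : ∀ (r s : T) (n : ℤ), (r : ℝ) = s + n / ((1 : ℕ) : ℝ) → r = s := by
    intro r s n h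
    rw [hi, hi, Nat.cast_one, div_one] at h
    field_simp at h
    have h2 : (i r : ℤ) = i s + e * n := by exact_mod_cast h
    have h3 : i r = i s := by
      have h4 := congrArg (· % (e : ℤ)) h2
      simp only [Int.add_mul_emod_self_left] at h4
      rw [Int.emod_eq_of_lt (by omega) (by exact_mod_cast hie r),
        Int.emod_eq_of_lt (by omega) (by exact_mod_cast hie s)] at h4
      exact_mod_cast h4
    exact Subtype.ext (by rw [hi, hi, h3])
  have hBspan : ∀ r : T, ∀ v ∈ (⊤ : Submodule k W), v ∈ hW.fil r → ∃ c : Fin n → k,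
      (∀ j, 0 ≤ νk (c j)) ∧ v - ∑ j, c j • B r j ∈ upper hW.fil r := by
    intro r v _ hv
    have h1 := hW.le_coe_mul hv (hinv r).ge
    rw [add_neg_cancel] at h1
    obtain ⟨c, hc, hcv⟩ := hspan _ h1
    refine ⟨c, hc, ?_⟩
    rw [hW.mem_upper_fil] at hcv ⊢
    have := hW.lt_coe_mul hcv (hπn (i r)).ge
    rw [zero_add, ← hi, sub_mul, inv_mul_cancel_right₀ (hne r), ← hBsum] at this
    exact this
  have H2 : ∀ t : ℝ, ∀ v ∈ (⊤ : Submodule k W), v ∈ hW.fil t → v ∉ upper hW.fil t →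
      ∃ r ∈ T, ∃ n : ℤ, t = r + n / ((1 : ℕ) : ℝ) := by
    intro t v _ hv hv'
    obtain ⟨m, hm, -⟩ := hW.exists_degree_eq hv hv'
    rw [hm]
    exact exists_mem_degreeReps hW.e_pos m
  have hli := hΛ.linearIndependent_sigma hν hB hBind hT
  have hsp : ⊤ ≤ Submodule.span k (Set.range fun p : Σ _ : T, Fin n => B p.1 p.2) := by
    intro v _
    obtain ⟨t, ht⟩ := hΛ.exhaust v
    obtain ⟨c, -, hc⟩ := hΛ.exists_repr_sigma hν hk.complete hB ⊤ (fun _ _ => trivial)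
      hBspan H2 trivial ht
    rw [hc]
    exact sum_mem fun p _ => Submodule.smul_mem _ _ (Submodule.subset_span ⟨p, rfl⟩)
  rw [Module.finrank_eq_card_basis (Module.Basis.mk hli hsp)]
  simp [hTcard]

end FundamentalIdentity

section ResidueRing

namespace IsDiscreteVal

variable {W : Type*} [DivisionRing W] {ν : W → EReal} {e : ℕ}

/-- The valuation ring. -/
def valRing (h : IsDiscreteVal ν e) : Subring W where
  carrier := {x | 0 ≤ ν x}
  zero_mem' := by simp [h.map_zero]
  one_mem' := h.map_one.ge
  add_mem' := fun ha hb => h.le_add ha hb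
  mul_mem' := fun ha hb => h.mul_nonneg ha hb
  neg_mem' := fun {x} hx => by simpa [h.map_neg] using hx

/-- The valuation ideal. -/
def valIdeal (h : IsDiscreteVal ν e) : Ideal h.valRing where
  carrier := {x | 0 < ν (x : W)}
  zero_mem' := by simp [h.map_zero]
  add_mem' := fun ha hb => h.lt_add ha hb
  smul_mem' := fun c _ hx => h.mul_pos_right c.2 hx

instance (h : IsDiscreteVal ν e) : h.valIdeal.IsTwoSided :=
  ⟨fun b ha => h.mul_pos_left ha b.2⟩

theorem mk_eq_mk_iff (h : IsDiscreteVal ν e) {x y : h.valRing} :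
    Ideal.Quotient.mk h.valIdeal x = Ideal.Quotient.mk h.valIdeal y ↔ 0 < ν (x - y : W) := by
  rw [Ideal.Quotient.eq]
  rfl

theorem card_quotient (h : IsDiscreteVal ν e) :
    Nat.card (h.valRing ⧸ h.valIdeal) = (upper h.fil 0).relIndex (h.fil 0) := by
  have h0 : ∀ x : W, 0 ≤ ν x ↔ x ∈ h.fil 0 := fun x => by rw [h.mem_fil, EReal.coe_zero]
  rw [AddSubgroup.relIndex, AddSubgroup.index]
  let f : h.valRing ≃ h.fil 0 := Equiv.subtypeEquivRight h0
  refine Nat.card_congr (Quotient.congr f fun x y => ?_)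
  refine Quotient.eq.symm.trans (Iff.trans ?_ Quotient.eq)
  change Ideal.Quotient.mk h.valIdeal x = Ideal.Quotient.mk h.valIdeal y ↔
    (QuotientAddGroup.mk (f x) : (h.fil 0) ⧸ (upper h.fil 0).addSubgroupOf (h.fil 0)) =
      QuotientAddGroup.mk (f y)
  rw [h.mk_eq_mk_iff, eq_comm, QuotientAddGroup.eq, AddSubgroup.mem_addSubgroupOf,
    h.mem_upper_fil, EReal.coe_zero]
  simp only [neg_add_eq_sub]
  exact Iff.rfl

/-- The residue ring of a discrete valuation is a field if it is finite; this collects the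
consequences for the valuation ring. -/
theorem exists_residue_generator (h : IsDiscreteVal ν e) {N : ℕ}
    (hN : (upper h.fil 0).relIndex (h.fil 0) = N) (hN0 : N ≠ 0) :
    1 < N ∧ 0 < ν (N : W) ∧ (∀ x, 0 ≤ ν x → 0 < ν (x ^ N - x)) ∧
      ∃ z, ν z = 0 ∧ (∀ i : ℕ, 0 < ν (z ^ i - 1) → N - 1 ∣ i) ∧
        ∀ x, ν x = 0 → ∃ i < N - 1, 0 < ν (x - z ^ i) := by
  classical
  rw [← card_quotient] at hN
  let K := h.valRing ⧸ h.valIdeal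
  let mk := Ideal.Quotient.mk h.valIdeal
  have hmk : ∀ {x y : h.valRing}, mk x = mk y ↔ 0 < ν (x - y : W) := h.mk_eq_mk_iff
  have hmk0 : ∀ {x : h.valRing}, mk x = 0 ↔ 0 < ν (x : W) := fun {x} => by
    rw [← _root_.map_zero mk, hmk]; simp
  have : Finite K := Nat.finite_of_card_ne_zero (hN ▸ hN0)
  have : Nontrivial K := ⟨0, 1, fun h01 => by
    rw [← _root_.map_zero mk, ← _root_.map_one mk, hmk] at h01
    simp [h.map_neg, h.map_one] at h01⟩
  have : NoZeroDivisors K := ⟨fun {a b} hab => by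
    obtain ⟨a, rfl⟩ := Ideal.Quotient.mk_surjective a
    obtain ⟨b, rfl⟩ := Ideal.Quotient.mk_surjective b
    rw [← _root_.map_mul, hmk0] at hab
    rw [hmk0, hmk0]
    by_contra! hcon
    have ha := le_antisymm hcon.1 a.2
    have hb := le_antisymm hcon.2 b.2
    simp [h.map_mul, ha, hb] at hab⟩
  have : IsDomain K := NoZeroDivisors.to_isDomain K
  let _ : Field K := (Finite.isDomain_to_isField K).toField
  let _ : Fintype K := Fintype.ofFinite K
  have hcard : Fintype.card K = N := by rw [← Nat.card_eq_fintype_card]; exact hN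
  have hpow : ∀ x : K, x ^ N = x := fun x => hcard ▸ FiniteField.pow_card x
  refine ⟨hcard ▸ Fintype.one_lt_card, ?_, fun x hx => ?_, ?_⟩
  · have h1 : mk (N : h.valRing) = 0 := by
      rw [map_natCast, ← hcard]
      exact FiniteField.cast_card_eq_zero K
    simpa using hmk0.1 h1
  · have h1 : mk (⟨x, hx⟩ ^ N) = mk ⟨x, hx⟩ := by rw [map_pow]; exact hpow _
    simpa using hmk.1 h1
  obtain ⟨g, hg⟩ := IsCyclic.exists_generator (α := Kˣ)
  have hord : orderOf g = N - 1 := by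
    rw [orderOf_eq_card_of_forall_mem_zpowers hg, Nat.card_eq_fintype_card, Fintype.card_units,
      hcard]
  obtain ⟨z, hz⟩ := Ideal.Quotient.mk_surjective (g : K)
  have hz' : mk z = g := hz
  refine ⟨z, ?_, fun i hi => ?_, fun x hx => ?_⟩
  · refine le_antisymm (not_lt.1 fun h1 => ?_) z.2
    exact g.ne_zero (hz'.symm.trans (hmk0.2 h1))
  · have h1 : mk (z ^ i) = mk 1 := hmk.2 (by simpa using hi)
    rw [map_pow, hz', _root_.map_one] at h1
    rw [← hord]
    exact orderOf_dvd_of_pow_eq_one (Units.ext (by simpa using h1))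
  · let x' : h.valRing := ⟨x, hx.ge⟩
    have hx0 : mk x' ≠ 0 := fun h1 => by
      have := hmk0.1 h1
      simp [x', hx] at this
    obtain ⟨i, hi, hix⟩ := (mem_zpowers_iff_mem_range_orderOf.1 (hg (Units.mk0 (mk x') hx0)) :
      Units.mk0 (mk x') hx0 ∈ Finset.image (g ^ ·) (Finset.range (orderOf g))) |>
        Finset.mem_image.1
    refine ⟨i, by rw [← hord]; simpa using hi, ?_⟩
    have h2 : mk x' = mk (z ^ i) := by
      rw [map_pow, hz', ← Units.val_pow_eq_pow_val, hix]
      rfl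
    simpa using hmk.1 h2

end IsDiscreteVal

end ResidueRing

section Teichmuller

namespace IsDiscreteVal

variable {W : Type*} [DivisionRing W] {ν : W → EReal} {e : ℕ}

theorem add_inv_le_pow_sub_pow (h : IsDiscreteVal ν e) {Q : ℕ} (hQ : 0 < ν (Q : W)) {a b : W}
    (hab : Commute a b) (ha : 0 ≤ ν a) (hb : 0 ≤ ν b) (hpos : 0 < ν (a - b)) {r : ℝ}
    (hr : (r : EReal) ≤ ν (a - b)) : ((r + (e : ℝ)⁻¹ : ℝ) : EReal) ≤ ν (a ^ Q - b ^ Q) := by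
  rw [← hab.mul_geom_sum₂]
  refine h.le_coe_mul hr (h.inv_le_of_pos ?_)
  have h1 : ∑ i ∈ Finset.range Q, a ^ i * b ^ (Q - 1 - i)
      = ∑ i ∈ Finset.range Q, (a ^ i - b ^ i) * b ^ (Q - 1 - i) + Q * b ^ (Q - 1) := by
    have h2 : (Q : W) * b ^ (Q - 1) = ∑ i ∈ Finset.range Q, b ^ i * b ^ (Q - 1 - i) := by
      rw [Finset.sum_congr rfl fun i hi => ?_, Finset.sum_const, Finset.card_range, nsmul_eq_mul]
      rw [← pow_add]
      congr 1
      have := Finset.mem_range.1 hi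
      omega
    rw [h2, ← Finset.sum_add_distrib]
    exact Finset.sum_congr rfl fun i _ => by rw [sub_mul, sub_add_cancel]
  rw [h1]
  refine h.lt_add ?_ (h.mul_pos_left hQ (h.pow_nonneg hb _))
  rw [← EReal.coe_zero]
  exact h.lt_sum _ fun i _ => by
    rw [EReal.coe_zero]
    exact h.mul_pos_left (hpos.trans_le (h.le_pow_sub_pow hab ha hb i)) (h.pow_nonneg hb _)

/-- Commuting Teichmüller elements with the same residue are equal. -/
theorem eq_of_pow_eq_self (h : IsDiscreteVal ν e) {Q : ℕ} (hQ : 0 < ν (Q : W)) {a b : W}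
    (hab : Commute a b) (ha : 0 ≤ ν a) (hb : 0 ≤ ν b) (hpos : 0 < ν (a - b)) (haQ : a ^ Q = a)
    (hbQ : b ^ Q = b) : a = b := by
  by_contra hne
  obtain ⟨r, hr⟩ := h.exists_real (sub_ne_zero.2 hne)
  have := h.add_inv_le_pow_sub_pow hQ hab ha hb hpos hr.ge
  rw [haQ, hbQ, hr, EReal.coe_le_coe_iff] at this
  have he : (0 : ℝ) < (e : ℝ)⁻¹ := by
    have := h.e_pos
    positivity
  linarith

/-- Teichmüller lifts. -/
theorem exists_teichmuller (h : IsDiscreteVal ν e) (hcomp : ValComplete ν) {Q : ℕ}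
    (hQ : 0 < ν (Q : W)) {x : W} (hx : 0 ≤ ν x) (hxQ : 0 < ν (x ^ Q - x)) :
    ∃ ω, ω ^ Q = ω ∧ 0 < ν (x - ω) ∧ ∀ M : ℝ, ∃ n : ℕ, (M : EReal) ≤ ν (ω - x ^ Q ^ n) := by
  have he : (0 : ℝ) < e := by exact_mod_cast h.e_pos
  set u : ℕ → W := fun n => x ^ Q ^ n with hu
  have hu0 : ∀ n, 0 ≤ ν (u n) := fun n => h.pow_nonneg hx _
  have hus : ∀ n, u (n + 1) = u n ^ Q := fun n => by simp only [hu]; rw [← pow_mul, pow_succ]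
  have hstep : ∀ n : ℕ, (((n + 1) / e : ℝ) : EReal) ≤ ν (u (n + 1) - u n) := by
    intro n
    induction n with
    | zero => simpa [hu] using h.inv_le_of_pos hxQ
    | succ n ih =>
      have hpos : 0 < ν (u (n + 1) - u n) := by
        refine lt_of_lt_of_le ?_ ih
        rw [← EReal.coe_zero, EReal.coe_lt_coe_iff]
        positivity
      have := h.add_inv_le_pow_sub_pow hQ ((Commute.refl x).pow_pow _ _) (hu0 _) (hu0 _) hpos ih
      rw [← hus, ← hus] at this
      convert this using 2
      push_cast
      ring
  have hdiff : ∀ m n : ℕ, m ≤ n → (((m + 1) / e : ℝ) : EReal) ≤ ν (u n - u m) := by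
    intro m n hmn
    rw [← Finset.sum_Ico_sub _ hmn]
    refine h.le_sum _ fun i hi => le_trans ?_ (hstep i)
    rw [EReal.coe_le_coe_iff]
    gcongr
    exact (Finset.mem_Ico.1 hi).1
  have hN : ∀ M : ℝ, ∃ N : ℕ, M ≤ (N + 1) / e := fun M => by
    obtain ⟨N, hN⟩ := exists_nat_ge (M * e)
    refine ⟨N, ?_⟩
    rw [le_div_iff₀ he]
    linarith
  obtain ⟨ω, hω⟩ := hcomp u fun M => by
    obtain ⟨N, hN⟩ := hN M
    refine ⟨N, fun m hm n hn => ?_⟩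
    have h1 := h.le_sub ((EReal.coe_le_coe_iff.2 hN).trans (hdiff N m hm))
      ((EReal.coe_le_coe_iff.2 hN).trans (hdiff N n hn))
    rwa [sub_sub_sub_cancel_right] at h1
  have hωx : Commute ω x := by
    refine sub_eq_zero.1 (h.eq_zero_of_forall_le fun M => ?_)
    obtain ⟨N, hN⟩ := hω M
    have h1 := hN N le_rfl
    have hc : u N * x = x * u N := ((Commute.refl x).pow_left _).eq
    have h2 := h.le_sub (h.le_coe_mul (b := 0) h1 (by simpa using hx))
      ((add_comm M 0).symm ▸ h.le_coe_mul (a := 0) (by simpa using hx) h1)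
    rw [add_zero] at h2
    rw [← h.map_neg]
    convert h2 using 2
    rw [sub_mul, mul_sub, hc]
    abel
  have hω0 : 0 < ν (x - ω) := by
    obtain ⟨N, hN⟩ := hω 1
    have h1 : 0 < ν (u N - ω) := lt_of_lt_of_le (by norm_num) (hN N le_rfl)
    have h2 : 0 < ν (u N - u 0) := lt_of_lt_of_le (by
      rw [← EReal.coe_zero, EReal.coe_lt_coe_iff]; positivity) (hdiff 0 N (Nat.zero_le N))
    have := h.lt_sub h1 h2
    rw [sub_sub_sub_cancel_left] at this
    simpa [hu] using this
  have hων : 0 ≤ ν ω := by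
    have := h.le_sub hx hω0.le
    rwa [sub_sub_cancel] at this
  refine ⟨ω, sub_eq_zero.1 (h.eq_zero_of_forall_le fun M => ?_), hω0, fun M => ?_⟩
  · obtain ⟨N, hN⟩ := hω M
    have h1 := (hN N le_rfl).trans (h.le_pow_sub_pow (hωx.symm.pow_left _) (hu0 N) hων Q)
    have h2 := h.le_sub (hN (N + 1) (Nat.le_succ N)) h1
    rw [← hus, sub_sub_sub_cancel_left] at h2
    exact h2
  · obtain ⟨N, hN⟩ := hω M
    exact ⟨N, by rw [h.map_sub_comm]; exact hN N le_rfl⟩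

end IsDiscreteVal

end Teichmuller

section Density

/-- A subspace which is dense in the graded sense is everything. -/
theorem IsNormFiltration.le_of_exists_sub_mem_upper {F V : Type*} [DivisionRing F]
    [AddCommGroup V] [Module F V] [Module.Finite F V] {ν : F → EReal} {e : ℕ}
    {Λ : ℝ → AddSubgroup V} (hν : IsDiscreteVal ν e) (hcomp : ValComplete ν)
    (hΛ : IsNormFiltration ν Λ) {X Y : Submodule F V} (hYX : Y ≤ X) (T : Finset ℝ)
    (H1 : ∀ r ∈ T, ∀ v ∈ X, v ∈ Λ r → ∃ y ∈ Y, y ∈ Λ r ∧ v - y ∈ upper Λ r)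
    (H2 : ∀ t : ℝ, ∀ v ∈ X, v ∈ Λ t → v ∉ upper Λ t → ∃ r ∈ T, ∃ n : ℤ, t = r + n / e) :
    X ≤ Y := by
  intro v hv
  obtain ⟨t, ht⟩ := hΛ.exhaust v
  choose n b hb hind hspan using fun r : ℝ =>
    hΛ.exists_residual_basis hν (Y.toAddSubgroup ⊓ Λ r) r inf_le_right
  obtain ⟨c, -, hc⟩ := hΛ.exists_repr_sigma hν hcomp (T := T) (ι := fun r => Fin (n r))
    (b := fun r => b r) (fun r j => (hb r j).2) X (fun r j => hYX (hb r j).1)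
    (fun r v hvX hv => by
      obtain ⟨y, hyY, hy, hvy⟩ := H1 r r.2 v hvX hv
      obtain ⟨c, hc, hcy⟩ := hspan r y ⟨hyY, hy⟩
      exact ⟨c, hc, by simpa using add_mem hvy hcy⟩) H2 hv ht
  rw [hc]
  exact Y.sum_mem fun p _ => Y.smul_mem _ (hb _ _).1

end Density

section Unramified

theorem IsDiscreteVal.comp_val {k E : Type*} [Field k] [Field E] [Algebra k E] {νk : k → EReal}
    {νE : E → EReal} {e q : ℕ} (hk : IsLocalValuation k νk 1 q) (hE : IsDiscreteVal νE e)
    (hcompat : ∀ c : k, νE (algebraMap k E c) = νk c) (L : IntermediateField k E)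
    (hL : ∀ x : L, (x : E) ≠ 0 → ∃ m : ℤ, νE (x : E) = ((m : ℝ) : EReal)) :
    IsDiscreteVal (fun x : L => νE x) 1 where
  e_pos := one_pos
  eq_top_iff := fun x => by simp [hE.eq_top_iff]
  map_mul := fun x y => hE.map_mul x y
  min_le_add := fun x y => hE.min_le_add x y
  values := fun x hx => by
    obtain ⟨m, hm⟩ := hL x (by simpa using hx)
    exact ⟨m, by simpa using hm⟩
  exists_uniformizer := by
    obtain ⟨π, hπ⟩ := hk.exists_uniformizer
    exact ⟨algebraMap k L π, by rw [← hπ, ← hcompat]; rfl⟩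

section

variable {k E : Type*} [Field k] [Field E] [Algebra k E]
  {νk : k → EReal} {νE : E → EReal} {e q : ℕ}

theorem IsDiscreteVal.isNormFiltration_fil_algebra (hE : IsDiscreteVal νE e)
    (hcompat : ∀ c : k, νE (algebraMap k E c) = νk c) : IsNormFiltration νk hE.fil :=
  hE.isNormFiltration_fil fun c w => by rw [Algebra.smul_def, hE.map_mul, hcompat]

theorem exists_degree_int (hE : IsDiscreteVal νE e) (L : IntermediateField k E)
    (hL : ∀ x : L, (x : E) ≠ 0 → ∃ m : ℤ, νE (x : E) = ((m : ℝ) : EReal))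
    (t : ℝ) (v : E) (hvL : v ∈ L) (hv : v ∈ hE.fil t) (hv' : v ∉ upper hE.fil t) :
    ∃ r ∈ ({0} : Finset ℝ), ∃ n : ℤ, t = r + n / ((1 : ℕ) : ℝ) := by
  obtain ⟨-, -, h1⟩ := hE.exists_degree_eq hv hv'
  obtain ⟨m, hm⟩ := hL ⟨v, hvL⟩ (hE.ne_zero_of_eq_coe h1)
  rw [hm, EReal.coe_eq_coe_iff] at h1
  exact ⟨0, by simp, m, by simp [h1]⟩

variable [FiniteDimensional k E]

/-- An unramified intermediate field is closed. -/
theorem IntermediateField.mem_of_forall_exists_le (hk : IsLocalValuation k νk 1 q)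
    (hE : IsDiscreteVal νE e) (hcompat : ∀ c : k, νE (algebraMap k E c) = νk c)
    (L : IntermediateField k E)
    (hL : ∀ x : L, (x : E) ≠ 0 → ∃ m : ℤ, νE (x : E) = ((m : ℝ) : EReal)) {v : E}
    (hv : ∀ M : ℝ, ∃ w ∈ L, (M : EReal) ≤ νE (v - w)) : v ∈ L := by
  have hν := hk.isDiscreteVal
  have hΛ := hE.isNormFiltration_fil_algebra hcompat
  let X : Submodule k E :=
    { carrier := {v | ∀ M : ℝ, ∃ w ∈ L, (M : EReal) ≤ νE (v - w)}
      zero_mem' := fun M => ⟨0, L.zero_mem, by simp [hE.map_zero]⟩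
      add_mem' := fun {a b} ha hb M => by
        obtain ⟨w, hw, h1⟩ := ha M
        obtain ⟨w', hw', h2⟩ := hb M
        refine ⟨w + w', L.add_mem hw hw', ?_⟩
        rw [add_sub_add_comm]
        exact hE.le_add h1 h2
      smul_mem' := fun c v hv M => by
        by_cases hc : c = 0
        · exact ⟨0, L.zero_mem, by simp [hc, hE.map_zero]⟩
        obtain ⟨a, ha⟩ := hν.exists_real hc
        obtain ⟨w, hw, h1⟩ := hv (M - a)
        refine ⟨c • w, L.smul_mem hw, ?_⟩
        rw [← smul_sub, Algebra.smul_def]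
        have := hE.le_coe_mul (x := algebraMap k E c) (by rw [hcompat]; exact ha.ge) h1
        rwa [add_sub_cancel] at this }
  have hXapp : ∀ v ∈ X, ∀ t, v ∈ hE.fil t → ∃ w ∈ L, w ∈ hE.fil t ∧
      v - w ∈ upper hE.fil t := by
    intro v hv t ht
    obtain ⟨w, hw, h1⟩ := hv (t + 1)
    have h2 : (t : EReal) < νE (v - w) :=
      lt_of_lt_of_le (EReal.coe_lt_coe_iff.2 (by linarith)) h1
    refine ⟨w, hw, ?_, hE.mem_upper_fil.2 h2⟩
    have := sub_mem ht (hE.mem_fil.2 h2.le)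
    rwa [sub_sub_cancel] at this
  have hXL : X ≤ Subalgebra.toSubmodule L.toSubalgebra := by
    refine hΛ.le_of_exists_sub_mem_upper hν hk.complete
      (fun v hv M => ⟨v, hv, by simp [hE.map_zero]⟩) {0}
      (fun r _ v hv hvr => hXapp v hv r hvr) fun t v hv hvt hvt' => ?_
    obtain ⟨w, hwL, hw, hvw⟩ := hXapp v hv t hvt
    refine exists_degree_int hE L hL t w hwL hw fun hw' => hvt' ?_
    have := add_mem hvw hw'
    rwa [sub_add_cancel] at this
  exact hXL hv

/-- A subalgebra containing an element whose powers represent all residues of units contains an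
unramified intermediate field. -/
theorem toSubmodule_le_of_powers (hk : IsLocalValuation k νk 1 q)
    (hE : IsDiscreteVal νE e) (hcompat : ∀ c : k, νE (algebraMap k E c) = νk c)
    (L : IntermediateField k E)
    (hL : ∀ x : L, (x : E) ≠ 0 → ∃ m : ℤ, νE (x : E) = ((m : ℝ) : EReal)) {ζ : E}
    (hζL : ζ ∈ L) (hζ0 : νE ζ = 0) (hζ : ∀ v ∈ L, νE v = 0 → ∃ i : ℕ, 0 < νE (v - ζ ^ i)) :
    Subalgebra.toSubmodule L.toSubalgebra = Subalgebra.toSubmodule (Algebra.adjoin k {ζ}) := by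
  have hadj : Algebra.adjoin k {ζ} ≤ L.toSubalgebra := Algebra.adjoin_le (by simpa using hζL)
  have hadj' : Subalgebra.toSubmodule (Algebra.adjoin k {ζ}) ≤
    Subalgebra.toSubmodule L.toSubalgebra := hadj
  refine le_antisymm ?_ hadj'
  refine (hE.isNormFiltration_fil_algebra hcompat).le_of_exists_sub_mem_upper hk.isDiscreteVal
    hk.complete hadj' {0} (fun r hr v hv hvr => ?_) (exists_degree_int hE L hL)
  obtain rfl : r = 0 := by simpa using hr
  by_cases hv' : v ∈ upper hE.fil 0
  · exact ⟨0, zero_mem _, zero_mem _, by simpa using hv'⟩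
  obtain ⟨-, -, h1⟩ := hE.exists_degree_eq hvr hv'
  obtain ⟨i, hi⟩ := hζ v hv (by simpa using h1)
  refine ⟨ζ ^ i, (Subalgebra.mem_toSubmodule _).2
    (pow_mem (Algebra.self_mem_adjoin_singleton k ζ) i), ?_, ?_⟩
  · rw [hE.mem_fil, EReal.coe_zero]
    exact hE.pow_nonneg hζ0.ge i
  · rwa [hE.mem_upper_fil, EReal.coe_zero]

/-- An unramified extension of degree `m` of a local field is generated by a Teichmüller
element of order prime to the residue characteristic. -/
theorem exists_unramified_generator (hk : IsLocalValuation k νk 1 q) (hE : IsDiscreteVal νE e)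
    (hEcomp : ValComplete νE) (hcompat : ∀ c : k, νE (algebraMap k E c) = νk c)
    (L : IntermediateField k E)
    (hL : ∀ x : L, (x : E) ≠ 0 → ∃ m : ℤ, νE (x : E) = ((m : ℝ) : EReal)) :
    ∃ ζ : E, νE ζ = 0 ∧ ζ ^ (q ^ Module.finrank k L - 1) = 1 ∧
      Subalgebra.toSubmodule L.toSubalgebra = Subalgebra.toSubmodule (Algebra.adjoin k {ζ}) := by
  have hLv := hE.comp_val hk hcompat L hL
  obtain ⟨n, hn, hn'⟩ := exists_relIndex_fil_eq hk hLv fun c => hcompat c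
  rw [one_mul] at hn'
  rw [hn']
  clear hn'
  have hQ0 : q ^ n ≠ 0 := by have := hk.one_lt_q; positivity
  generalize q ^ n = Q at hn hQ0 ⊢
  obtain ⟨hQ1, hQ, hpow, z, hz, -, hzgen⟩ := hLv.exists_residue_generator hn hQ0
  have hQ' : 0 < νE (Q : E) := by simpa using hQ
  obtain ⟨ζ, hζ, hzζ, hζlim⟩ := hE.exists_teichmuller hEcomp hQ' (x := (z : E)) hz.ge
    (by simpa using hpow z hz.ge)
  have hζ0 : νE ζ = 0 := hE.map_eq_zero_of_sub_pos (y := (z : E)) hz (by rwa [hE.map_sub_comm])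
  have hζne : ζ ≠ 0 := hE.ne_zero_of_eq_coe (a := 0) (by simpa using hζ0)
  have hζL : ζ ∈ L := L.mem_of_forall_exists_le hk hE hcompat hL fun M => by
    obtain ⟨i, hi⟩ := hζlim M
    exact ⟨_, pow_mem z.2 _, hi⟩
  refine ⟨ζ, hζ0, ?_, toSubmodule_le_of_powers hk hE hcompat L hL hζL hζ0 fun v hv hv0 => ?_⟩
  · refine mul_left_cancel₀ hζne ?_
    rw [← pow_succ', Nat.sub_add_cancel hQ1.le, hζ, mul_one]
  · obtain ⟨i, -, hi⟩ := hzgen ⟨v, hv⟩ hv0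
    refine ⟨i, ?_⟩
    have h2 := hzζ.trans_le (hE.le_pow_sub_pow (Commute.all _ _) hz.ge hζ0.ge i)
    have h3 : 0 < νE (v - (z : E) ^ i) := by simpa using hi
    have := hE.lt_add h3 h2
    rwa [sub_add_sub_cancel] at this

end

end Unramified

section TameFrame

/-- A generator `ω` of the group of Teichmüller elements and a uniformizer `ϖ` normalizing it. -/
structure IsTameFrame {F : Type*} [DivisionRing F] (ν : F → EReal) (d N : ℕ) (ω ϖ : F) (s : ℕ) :
    Prop where
  one_lt : 1 < N
  natCast_pos : 0 < ν (N : F)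
  val_root : ν ω = 0
  pow_eq_one : ω ^ (N - 1) = 1
  dvd_of_pow_eq_one : ∀ i : ℕ, ω ^ i = 1 → N - 1 ∣ i
  exists_sub_pow : ∀ x, ν x = 0 → ∃ i < N - 1, 0 < ν (x - ω ^ i)
  val_unif : ν ϖ = (((d : ℝ)⁻¹ : ℝ) : EReal)
  unif_mul : ϖ * ω = ω ^ s * ϖ

namespace IsDiscreteVal

variable {F : Type*} [DivisionRing F] {ν : F → EReal} {d : ℕ}

theorem pow_sub_pow_pos (h : IsDiscreteVal ν d) {x y : F} (hx : 0 ≤ ν x) (hxy : 0 < ν (x - y))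
    (n : ℕ) : 0 < ν (x ^ n - y ^ n) := by
  have hy : 0 ≤ ν y := by
    have := h.le_sub hx hxy.le
    rwa [sub_sub_cancel] at this
  induction n with
  | zero => simp [h.map_zero]
  | succ n ih =>
    have h1 : x ^ (n + 1) - y ^ (n + 1) = x ^ n * (x - y) + (x ^ n - y ^ n) * y := by
      rw [pow_succ, pow_succ]; noncomm_ring
    rw [h1]
    exact h.lt_add (h.mul_pos_right (h.pow_nonneg hx n) hxy) (h.mul_pos_left ih hy)

theorem map_inv_eq_zero (h : IsDiscreteVal ν d) {x : F} (hx : ν x = 0) : ν x⁻¹ = 0 := by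
  simpa using h.map_inv (a := 0) (by simpa using hx)

theorem map_pow_eq_zero (h : IsDiscreteVal ν d) {x : F} (hx : ν x = 0) (n : ℕ) :
    ν (x ^ n) = 0 := by
  simpa using h.pow_eq_coe (a := 0) (by simpa using hx) n

theorem exists_isTameFrame (h : IsDiscreteVal ν d) (hcomp : ValComplete ν) {N : ℕ}
    (hN : (upper h.fil 0).relIndex (h.fil 0) = N) (hN0 : N ≠ 0) :
    ∃ (ω ϖ : F) (s : ℕ), IsTameFrame ν d N ω ϖ s := by
  obtain ⟨hN1, hNpos, hpow, z, hz, hzdvd, hzgen⟩ := h.exists_residue_generator hN hN0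
  obtain ⟨ω, hω, hzω, -⟩ := h.exists_teichmuller hcomp hNpos hz.ge (hpow z hz.ge)
  have hω0 : ν ω = 0 := h.map_eq_zero_of_sub_pos hz (by rwa [h.map_sub_comm])
  have hωne : ω ≠ 0 := h.ne_zero_of_eq_coe (a := 0) (by simpa using hω0)
  have hω1 : ω ^ (N - 1) = 1 := mul_left_cancel₀ hωne (by
    rw [← pow_succ', Nat.sub_add_cancel hN1.le, hω, mul_one])
  have hgen : ∀ x, ν x = 0 → ∃ i < N - 1, 0 < ν (x - ω ^ i) := fun x hx => by
    obtain ⟨i, hi, hix⟩ := hzgen x hx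
    refine ⟨i, hi, ?_⟩
    have := h.lt_add hix (h.pow_sub_pow_pos hz.ge hzω i)
    rwa [sub_add_sub_cancel] at this
  obtain ⟨π, hπ⟩ := h.exists_uniformizer
  have hπ0 : π ≠ 0 := h.ne_zero_of_eq_coe hπ
  set u := π * ω * π⁻¹ with hu
  have hu0 : ν u = 0 := by
    have h1 := h.mul_eq_coe (h.mul_eq_coe hπ (b := 0) (by simpa using hω0)) (h.map_inv hπ)
    rw [h1]; simp
  obtain ⟨s, -, hs⟩ := hgen u hu0
  have hupow : ∀ a : ℕ, π * ω⁻¹ ^ a * π⁻¹ = (u ^ a)⁻¹ := fun a => by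
    have h1 : u ^ a = π * ω ^ a * π⁻¹ := by
      induction a with
      | zero => simp [hπ0]
      | succ a ih => rw [pow_succ, ih, hu, pow_succ]; simp [mul_assoc, hπ0]
    rw [h1]
    simp [mul_assoc]
  let ϖ : F := ∑ a ∈ Finset.range (N - 1), (ω ^ s) ^ a * π * ω⁻¹ ^ a
  have hconj : ω ^ s * ϖ * ω⁻¹ = ϖ := by
    have h1 : ω ^ s * ϖ * ω⁻¹
        = ∑ a ∈ Finset.range (N - 1), (ω ^ s) ^ (a + 1) * π * ω⁻¹ ^ (a + 1) := by
      simp only [ϖ, Finset.mul_sum, Finset.sum_mul]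
      refine Finset.sum_congr rfl fun a _ => ?_
      rw [pow_succ' (ω ^ s), pow_succ ω⁻¹]
      simp only [mul_assoc]
    have h2 := Finset.sum_range_succ (fun a => (ω ^ s) ^ a * π * ω⁻¹ ^ a) (N - 1)
    rw [Finset.sum_range_succ', ← h1] at h2
    have h3 : (ω ^ s) ^ (N - 1) * π * ω⁻¹ ^ (N - 1) = (ω ^ s) ^ 0 * π * ω⁻¹ ^ 0 := by
      rw [← pow_mul, mul_comm s, pow_mul, hω1, inv_pow, hω1]; simp
    rw [h3] at h2
    exact add_right_cancel h2
  have hterm : ∀ a : ℕ, 0 < ν ((ω ^ s) ^ a * π * ω⁻¹ ^ a * π⁻¹ - 1) := fun a => by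
    have hua : u ^ a ≠ 0 := h.ne_zero_of_eq_coe (a := 0) (by simpa using h.map_pow_eq_zero hu0 a)
    have h1 : (ω ^ s) ^ a * π * ω⁻¹ ^ a * π⁻¹ - 1 = ((ω ^ s) ^ a - u ^ a) * (u ^ a)⁻¹ := by
      rw [sub_mul, mul_inv_cancel₀ hua, ← hupow]
      simp only [mul_assoc]
    rw [h1]
    refine h.mul_pos_left (h.pow_sub_pow_pos (h.map_pow_eq_zero hω0 s).ge ?_ a)
      (h.map_inv_eq_zero (h.map_pow_eq_zero hu0 a)).ge
    rwa [h.map_sub_comm]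
  have hsum : 0 < ν (ϖ * π⁻¹ - (-1)) := by
    have h1 : ϖ * π⁻¹ - (-1)
        = ∑ a ∈ Finset.range (N - 1), ((ω ^ s) ^ a * π * ω⁻¹ ^ a * π⁻¹ - 1) + N := by
      simp only [ϖ, Finset.sum_mul, Finset.sum_sub_distrib, Finset.sum_const, Finset.card_range,
        nsmul_eq_mul, mul_one]
      rw [Nat.cast_sub hN1.le, Nat.cast_one]
      abel
    rw [h1]
    refine h.lt_add ?_ hNpos
    rw [← EReal.coe_zero]
    exact h.lt_sum _ fun a _ => by rw [EReal.coe_zero]; exact hterm a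
  have hval : ν (ϖ * π⁻¹) = 0 :=
    h.map_eq_zero_of_sub_pos (by rw [h.map_neg, h.map_one]) hsum
  refine ⟨ω, ϖ, s, hN1, hNpos, hω0, hω1, fun i hi => hzdvd i ?_, hgen, ?_, ?_⟩
  · rw [← hi]
    exact h.pow_sub_pow_pos hz.ge hzω i
  · have := h.mul_eq_coe (a := 0) (by simpa using hval) hπ
    rwa [inv_mul_cancel_right₀ hπ0, zero_add] at this
  · nth_rw 1 [← hconj]
    rw [inv_mul_cancel_right₀ hωne]

end IsDiscreteVal

namespace IsTameFrame

variable {F : Type*} [DivisionRing F] {ν : F → EReal} {d N s : ℕ} {ω ϖ : F}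

theorem root_ne_zero (hω : IsTameFrame ν d N ω ϖ s) (h : IsDiscreteVal ν d) : ω ≠ 0 :=
  h.ne_zero_of_eq_coe (a := 0) (by simpa using hω.val_root)

theorem unif_ne_zero (hω : IsTameFrame ν d N ω ϖ s) (h : IsDiscreteVal ν d) : ϖ ≠ 0 :=
  h.ne_zero_of_eq_coe hω.val_unif

theorem pow_mod (hω : IsTameFrame ν d N ω ϖ s) (i : ℕ) : ω ^ (i % (N - 1)) = ω ^ i := by
  conv_rhs => rw [← Nat.mod_add_div i (N - 1), pow_add, pow_mul, hω.pow_eq_one, one_pow, mul_one]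

theorem pow_injOn (hω : IsTameFrame ν d N ω ϖ s) (h : IsDiscreteVal ν d) :
    Set.InjOn (fun i => ω ^ i) (Set.Iio (N - 1)) := by
  have key : ∀ i j : ℕ, i ≤ j → j < N - 1 → ω ^ i = ω ^ j → i = j := by
    intro i j hij hj hpow
    have h1 : ω ^ (j - i) = 1 := by
      refine mul_left_cancel₀ (pow_ne_zero i (hω.root_ne_zero h)) ?_
      rw [← pow_add, Nat.add_sub_cancel' hij, hpow, mul_one]
    have := Nat.eq_zero_of_dvd_of_lt (hω.dvd_of_pow_eq_one _ h1) (by omega)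
    omega
  intro i hi j hj hij
  rcases le_total i j with hle | hle
  · exact key i j hle hj hij
  · exact (key j i hle hi hij.symm).symm

/-- The Teichmüller elements form a residue system. -/
theorem exists_residueSystem (hω : IsTameFrame ν d N ω ϖ s) (h : IsDiscreteVal ν d) :
    ∃ S : Finset F, IsResidueSystem ν S ∧ S.card = N ∧ ∀ y ∈ S, y = 0 ∨ ∃ i, y = ω ^ i := by
  classical
  let S : Finset F := insert 0 ((Finset.range (N - 1)).image fun i => ω ^ i)
  have hS : ∀ y ∈ S, y = 0 ∨ ∃ i, y = ω ^ i := fun y hy => by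
    rcases Finset.mem_insert.1 hy with hy | hy
    · exact Or.inl hy
    · obtain ⟨i, -, hi⟩ := Finset.mem_image.1 hy
      exact Or.inr ⟨i, hi.symm⟩
  have hcomm : ∀ y ∈ S, ∀ y' ∈ S, Commute y y' := fun y hy y' hy' => by
    rcases hS y hy with rfl | ⟨i, rfl⟩
    · exact Commute.zero_left _
    rcases hS y' hy' with rfl | ⟨j, rfl⟩
    · exact Commute.zero_right _
    exact (Commute.refl ω).pow_pow i j
  have hωN : ω ^ N = ω := by
    conv_lhs => rw [← Nat.sub_add_cancel hω.one_lt.le, pow_succ, hω.pow_eq_one, one_mul]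
  have hpowN : ∀ y ∈ S, y ^ N = y := fun y hy => by
    rcases hS y hy with rfl | ⟨i, rfl⟩
    · exact zero_pow (by have := hω.one_lt; omega)
    · rw [← pow_mul, mul_comm, pow_mul, hωN]
  have hS0 : ∀ y ∈ S, 0 ≤ ν y := fun y hy => by
    rcases hS y hy with rfl | ⟨i, rfl⟩
    · simp [h.map_zero]
    · exact h.pow_nonneg hω.val_root.ge i
  refine ⟨S, ⟨hS0, fun x hx => ?_⟩, ?_, hS⟩
  · refine existsUnique_of_exists_of_unique ?_ fun y y' hy hy' => ?_
    · by_cases hx0 : 0 < ν x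
      · exact ⟨0, by simp [S], by simpa using hx0⟩
      · obtain ⟨i, hi, hxi⟩ := hω.exists_sub_pow x (le_antisymm (not_lt.1 hx0) hx)
        exact ⟨ω ^ i, Finset.mem_insert_of_mem (Finset.mem_image.2 ⟨i, by simpa using hi, rfl⟩),
          hxi⟩
    · have := h.lt_sub hy'.2 hy.2
      rw [sub_sub_sub_cancel_left] at this
      exact h.eq_of_pow_eq_self hω.natCast_pos (hcomm y hy.1 y' hy'.1) (hS0 y hy.1)
        (hS0 y' hy'.1) this (hpowN y hy.1) (hpowN y' hy'.1)
  · rw [Finset.card_insert_of_notMem, Finset.card_image_of_injOn, Finset.card_range,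
      Nat.sub_add_cancel hω.one_lt.le]
    · intro i hi j hj hij
      exact hω.pow_injOn h (by simpa using hi) (by simpa using hj) hij
    · intro h0
      obtain ⟨i, -, hi⟩ := Finset.mem_image.1 h0
      exact pow_ne_zero i (hω.root_ne_zero h) hi

/-- A finite dimensional division algebra over a local field is generated by a tame frame. -/
theorem commute_all {k : Type*} [Field k] [Algebra k F] [Module.Finite k F] {νk : k → EReal}
    {q : ℕ} (hk : IsLocalValuation k νk 1 q) (hω : IsTameFrame ν d N ω ϖ s)
    (h : IsDiscreteVal ν d) (hcompat : ∀ c : k, ν (algebraMap k F c) = νk c) {z : F}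
    (hzω : Commute z ω) (hzϖ : Commute z ϖ) (w : F) : Commute z w := by
  have hΛ : IsNormFiltration νk h.fil := h.isNormFiltration_fil fun c w => by
    rw [Algebra.smul_def, h.map_mul, hcompat]
  let A : Subalgebra k F := Algebra.adjoin k {ω, ϖ}
  have hωA : ω ∈ A := Algebra.subset_adjoin (by simp)
  have hϖA : ϖ ∈ A := Algebra.subset_adjoin (by simp)
  have htop : (⊤ : Submodule k F) ≤ Subalgebra.toSubmodule A := by
    refine hΛ.le_of_exists_sub_mem_upper hk.isDiscreteVal hk.complete le_top (degreeReps d)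
      (fun r hr v _ hv => ?_) fun t v _ hv hv' => ?_
    · by_cases hv' : v ∈ upper h.fil r
      · exact ⟨0, zero_mem _, zero_mem _, by simpa using hv'⟩
      obtain ⟨-, -, h1⟩ := h.exists_degree_eq hv hv'
      obtain ⟨i, -, rfl⟩ := Finset.mem_image.1 hr
      have h2 := h.pow_eq_coe hω.val_unif i
      rw [← div_eq_mul_inv] at h2
      have hne := h.ne_zero_of_eq_coe h2
      have h3 := h.mul_eq_coe h1 (h.map_inv h2)
      rw [add_neg_cancel, EReal.coe_zero] at h3
      obtain ⟨j, -, hj⟩ := hω.exists_sub_pow _ h3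
      have h4 := h.lt_coe_mul (a := 0) (by simpa using hj) h2.ge
      rw [sub_mul, inv_mul_cancel_right₀ hne, zero_add] at h4
      refine ⟨ω ^ j * ϖ ^ i, (Subalgebra.mem_toSubmodule _).2
        (mul_mem (pow_mem hωA j) (pow_mem hϖA i)), ?_, h.mem_upper_fil.2 h4⟩
      rw [h.mem_fil, h.map_mul, h.map_pow_eq_zero hω.val_root, zero_add, h2]
    · obtain ⟨m, hm, -⟩ := h.exists_degree_eq hv hv'
      rw [hm]
      exact exists_mem_degreeReps h.e_pos m
  have hle : A ≤ Subalgebra.centralizer k {z} := Algebra.adjoin_le (by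
    rintro x (rfl | rfl)
    · rw [SetLike.mem_coe, Subalgebra.mem_centralizer_iff]
      rintro _ rfl
      exact hzω.eq
    · rw [SetLike.mem_coe, Subalgebra.mem_centralizer_iff]
      rintro _ rfl
      exact hzϖ.eq)
  have := hle ((Subalgebra.mem_toSubmodule A).1 (htop (Submodule.mem_top (x := w))))
  rw [Subalgebra.mem_centralizer_iff] at this
  exact this z rfl

end IsTameFrame

end TameFrame

section FieldAction

/-- Elements of the valuation ring of a finite extension have bounded coordinates. -/
theorem exists_bounded_repr {k E : Type*} [Field k] [Field E] [Algebra k E]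
    [FiniteDimensional k E] {νk : k → EReal} {νE : E → EReal} {e q : ℕ}
    (hk : IsLocalValuation k νk 1 q) (hE : IsDiscreteVal νE e)
    (hcompat : ∀ c : k, νE (algebraMap k E c) = νk c) :
    ∃ (J : Type) (_ : Fintype J) (b : J → E), ∀ x, 0 ≤ νE x →
      ∃ c : J → k, (∀ j, ((-1 : ℝ) : EReal) ≤ νk (c j)) ∧ x = ∑ j, c j • b j := by
  have hν := hk.isDiscreteVal
  have hΛ := hE.isNormFiltration_fil_algebra hcompat
  choose n b hb hind hspan using fun r : ℝ => hΛ.exists_residual_basis hν (hE.fil r) r le_rfl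
  refine ⟨Σ r : degreeReps e, Fin (n r), inferInstance, fun p => b p.1 p.2, fun x hx => ?_⟩
  obtain ⟨c, hc, hcx⟩ := hΛ.exists_repr_sigma hν hk.complete (T := degreeReps e)
    (ι := fun r => Fin (n r)) (b := fun r => b r) (fun r j => hb r j) ⊤ (fun r j => trivial)
    (fun r v _ hv => hspan r v hv)
    (fun t v _ hv hv' => by
      obtain ⟨m, hm, -⟩ := hE.exists_degree_eq hv hv'
      rw [hm]
      exact exists_mem_degreeReps hE.e_pos m) (t := 0) (v := x) trivial (by simpa [hE.mem_fil])
  refine ⟨c, fun p => le_trans (EReal.coe_le_coe_iff.2 ?_) (hc p), hcx⟩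
  obtain ⟨i, hi, hip⟩ := Finset.mem_image.1 p.1.2
  have he : (0 : ℝ) < e := by exact_mod_cast hE.e_pos
  have : (i / e : ℝ) ≤ 1 := by
    rw [div_le_one he]
    exact_mod_cast (Finset.mem_range.1 hi).le
  rw [← hip]
  linarith

/-- The operator `A` shifts the filtration `Λ` by `s`. -/
def HasShift {F V : Type*} [DivisionRing F] [AddCommGroup V] [Module F V]
    (Λ : ℝ → AddSubgroup V) (A : Module.End F V) (s : ℝ) : Prop :=
  ∀ (t : ℝ) (v : V), A v ∈ Λ (t + s) ↔ v ∈ Λ t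

namespace HasShift

variable {F V : Type*} [DivisionRing F] [AddCommGroup V] [Module F V]
  {Λ : ℝ → AddSubgroup V} {A B : Module.End F V} {s s' : ℝ}

theorem mul (hA : HasShift Λ A s) (hB : HasShift Λ B s') : HasShift Λ (A * B) (s + s') :=
  fun t v => by rw [Module.End.mul_apply, add_comm s, ← add_assoc, hA, hB]

theorem one : HasShift Λ (1 : Module.End F V) 0 := fun t v => by simp

theorem pow (hA : HasShift Λ A s) (n : ℕ) : HasShift Λ (A ^ n) (n * s) := by
  induction n with
  | zero => simpa using one
  | succ n ih =>
    rw [pow_succ, Nat.cast_succ, add_mul, one_mul]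
    exact ih.mul hA

theorem of_mul_eq_one (hA : HasShift Λ A s) (hAB : A * B = 1) : HasShift Λ B (-s) :=
  fun t v => by
    rw [← hA (t + -s), neg_add_cancel_right, ← Module.End.mul_apply, hAB, Module.End.one_apply]

theorem of_image_eq (hBA : B * A = 1) (h : ∀ t, ⇑A '' (Λ t : Set V) = (Λ (t - s) : Set V)) :
    HasShift Λ A (-s) := fun t v => by
  have hinj : Function.Injective A := fun x y hxy => by
    have := congrArg B hxy
    rwa [← Module.End.mul_apply, ← Module.End.mul_apply, hBA] at this
  rw [← sub_eq_add_neg, ← SetLike.mem_coe, ← h, hinj.mem_set_image, SetLike.mem_coe]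

theorem mem_upper_iff {ν : F → EReal} (hΛ : IsNormFiltration ν Λ) (hA : HasShift Λ A s) (t : ℝ)
    (v : V) : A v ∈ upper Λ (t + s) ↔ v ∈ upper Λ t := by
  rw [hΛ.mem_upper, hΛ.mem_upper]
  constructor
  · rintro ⟨r, hr, h⟩
    refine ⟨r - s, by linarith, ?_⟩
    rwa [← hA, sub_add_cancel]
  · rintro ⟨r, hr, h⟩
    exact ⟨r + s, by linarith, (hA r v).2 h⟩

end HasShift

variable {k E F V : Type*} [Field k] [Field E] [Algebra k E] [FiniteDimensional k E]
  [DivisionRing F] [Algebra k F] [AddCommGroup V] [Module F V]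
  {νk : k → EReal} {νE : E → EReal} {ν : F → EReal} {e q d : ℕ} {Λ : ℝ → AddSubgroup V}

/-- A unit of `E` cannot shift a filtration normalized by `E` to the left. -/
theorem HasShift.nonneg_of_unit [Nontrivial V] (hk : IsLocalValuation k νk 1 q)
    (hE : IsDiscreteVal νE e) (hcE : ∀ c : k, νE (algebraMap k E c) = νk c)
    (hcF : ∀ c : k, ν (algebraMap k F c) = νk c) (hΛ : IsNormFiltration ν Λ)
    (ρ : E →+* Module.End F V) (hρ : ∀ c v, ρ (algebraMap k E c) v = algebraMap k F c • v)
    (hΛE : ∀ x : E, x ≠ 0 → ∃ s, HasShift Λ (ρ x) s) {y : E} (hy : νE y = 0) {s : ℝ}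
    (hs : HasShift Λ (ρ y) s) : 0 ≤ s := by
  obtain ⟨J, _, b, hb⟩ := exists_bounded_repr hk hE hcE
  have hsh : ∀ j, ∃ s : ℝ, ∀ t, ∀ v ∈ Λ t, ρ (b j) v ∈ Λ (t + s) := fun j => by
    by_cases h0 : b j = 0
    · exact ⟨0, fun t v _ => by simp [h0]⟩
    · obtain ⟨s, hs⟩ := hΛE _ h0
      exact ⟨s, fun t v hv => (hs t v).2 hv⟩
  choose σ hσ using hsh
  let C : ℝ := 1 + ∑ j, |σ j|
  have hbdd : ∀ x, 0 ≤ νE x → ∀ t, ∀ v ∈ Λ t, ρ x v ∈ Λ (t - C) := fun x hx t v hv => by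
    obtain ⟨c, hc, hcx⟩ := hb x hx
    rw [hcx, map_sum, LinearMap.sum_apply]
    refine sum_mem fun j _ => ?_
    rw [Algebra.smul_def, map_mul, Module.End.mul_apply, hρ]
    refine hΛ.anti _ _ ?_ (hΛ.smul_mem (-1) _ _ _ (by rw [hcF]; exact hc j) (hσ j t v hv))
    have h1 := neg_abs_le (σ j)
    have h2 := Finset.single_le_sum (f := fun j => |σ j|) (fun j _ => abs_nonneg _)
      (Finset.mem_univ j)
    simp only [C]
    linarith
  by_contra! hneg
  obtain ⟨v, hv0⟩ := exists_ne (0 : V)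
  obtain ⟨t, hvt, hvt'⟩ := hΛ.exists_degree hv0
  obtain ⟨n, hn⟩ := exists_nat_gt (C / -s)
  rw [div_lt_iff₀ (by linarith)] at hn
  refine hvt' (hΛ.mem_upper.2 ⟨t - C - n * s, by linarith, ?_⟩)
  rw [← hs.pow n, sub_add_cancel, ← map_pow]
  exact hbdd _ (hE.map_pow_eq_zero hy n).ge t v hvt

/-- An element of `E` shifts a filtration normalized by `E` by its valuation. -/
theorem hasShift_of_val_eq (hk : IsLocalValuation k νk 1 q)
    (hE : IsDiscreteVal νE e) (hcE : ∀ c : k, νE (algebraMap k E c) = νk c)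
    (hν : IsDiscreteVal ν d)
    (hcF : ∀ c : k, ν (algebraMap k F c) = νk c) (hΛ : IsNormFiltration ν Λ)
    (ρ : E →+* Module.End F V) (hρ : ∀ c v, ρ (algebraMap k E c) v = algebraMap k F c • v)
    (hΛE : ∀ x : E, x ≠ 0 → ∃ s, HasShift Λ (ρ x) s) {x : E} {a : ℝ} (hx : νE x = (a : EReal)) :
    HasShift Λ (ρ x) a := by
  cases subsingleton_or_nontrivial V
  · intro t v
    rw [Subsingleton.elim (ρ x v) 0, Subsingleton.elim v 0]
    simp
  have hx0 := hE.ne_zero_of_eq_coe hx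
  obtain ⟨s, hs⟩ := hΛE x hx0
  obtain ⟨m, hm⟩ := hE.values x hx0
  obtain ⟨π, hπ⟩ := hk.exists_uniformizer
  have hπm := hk.isDiscreteVal.zpow_eq_coe hπ (-m)
  have hpsh : HasShift Λ (ρ (algebraMap k E (π ^ (-m)))) ((-m : ℤ) * ((1 : ℕ) : ℝ)⁻¹) := by
    intro t v
    rw [hρ]
    exact hΛ.smul_mem_iff hν (by rw [hcF]; exact hπm)
  have he : (0 : ℝ) < e := by exact_mod_cast hE.e_pos
  have ha : a = m / e := by rwa [hx, EReal.coe_eq_coe_iff] at hm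
  set y := x ^ e * algebraMap k E (π ^ (-m)) with hy
  have hysh : HasShift Λ (ρ y) (e * s - m) := by
    rw [hy, map_mul, map_pow]
    convert (hs.pow e).mul hpsh using 1
    push_cast
    ring
  have hy0 : νE y = 0 := by
    have := hE.mul_eq_coe (hE.pow_eq_coe hx e) ((hcE _).trans hπm)
    rw [hy, this, ha, ← EReal.coe_zero, EReal.coe_eq_coe_iff]
    push_cast
    field_simp
    ring
  have hyne : y ≠ 0 := hE.ne_zero_of_eq_coe (a := 0) (by simpa using hy0)
  have h1 := hysh.nonneg_of_unit hk hE hcE hcF hΛ ρ hρ hΛE hy0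
  have h2 := (hysh.of_mul_eq_one (B := ρ y⁻¹)
    (by rw [← map_mul, mul_inv_cancel₀ hyne, map_one])).nonneg_of_unit hk hE hcE hcF hΛ ρ hρ hΛE
      (hE.map_inv_eq_zero hy0)
  have h3 : s = a := by
    rw [ha, eq_div_iff he.ne']
    linarith
  rwa [← h3]

end FieldAction

section Eigenspaces

section Projection

variable {F V : Type*} [DivisionRing F] [AddCommGroup V] [Module F V]

/-- The eigenspace of `Z` for the (non-central) scalar `θ`, as a subgroup. -/
def eigengroup (Z : Module.End F V) (θ : F) : AddSubgroup V where
  carrier := {v | Z v = θ • v}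
  zero_mem' := by simp
  add_mem' := fun {a b} (ha : Z a = θ • a) (hb : Z b = θ • b) => by
    change Z (a + b) = θ • (a + b)
    rw [map_add, ha, hb, smul_add]
  neg_mem' := fun {a} (ha : Z a = θ • a) => by
    change Z (-a) = θ • -a
    rw [map_neg, ha, smul_neg]

variable {Z : Module.End F V} {θ η : F} {M : ℕ}

theorem mem_eigengroup {v : V} : v ∈ eigengroup Z θ ↔ Z v = θ • v := Iff.rfl

theorem smul_mem_eigengroup {c : F} {v : V} (hc : Commute c θ) (hv : v ∈ eigengroup Z θ) :
    c • v ∈ eigengroup Z θ := by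
  rw [mem_eigengroup] at *
  rw [map_smul, hv, smul_smul, smul_smul, hc.eq]

theorem pow_apply_of_mem_eigengroup {v : V} (hv : v ∈ eigengroup Z θ) (a : ℕ) :
    (Z ^ a) v = θ ^ a • v := by
  induction a with
  | zero => simp
  | succ a ih =>
    rw [pow_succ, Module.End.mul_apply, mem_eigengroup.1 hv, map_smul, ih, smul_smul, ← pow_succ']

/-- `M` times the projection onto the eigenspace of `θ`, where `Z ^ M = 1`. -/
def eigenproj (Z : Module.End F V) (M : ℕ) (θ : F) : V →+ V :=
  ∑ a ∈ Finset.range M, (DistribSMul.toAddMonoidHom V (θ ^ a)⁻¹).comp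
    (Z ^ a).toAddMonoidHom

theorem eigenproj_apply (v : V) :
    eigenproj Z M θ v = ∑ a ∈ Finset.range M, (θ ^ a)⁻¹ • (Z ^ a) v := by
  simp [eigenproj]

theorem eigenproj_mem (hZ : Z ^ M = 1) (hθ : θ ^ M = 1) (hθ0 : θ ≠ 0) (v : V) :
    eigenproj Z M θ v ∈ eigengroup Z θ := by
  rw [mem_eigengroup, eigenproj_apply, map_sum, Finset.smul_sum]
  have h1 : ∀ a, Z ((θ ^ a)⁻¹ • (Z ^ a) v) = θ • (θ ^ (a + 1))⁻¹ • (Z ^ (a + 1)) v := fun a => by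
    rw [map_smul, ← Module.End.mul_apply, ← pow_succ', smul_smul, pow_succ θ, mul_inv_rev,
      mul_inv_cancel_left₀ hθ0]
  simp only [h1, ← Finset.smul_sum]
  congr 1
  have h2 := Finset.sum_range_succ (fun a => (θ ^ a)⁻¹ • (Z ^ a) v) M
  rw [Finset.sum_range_succ'] at h2
  simp only [hθ, hZ, pow_zero] at h2
  exact add_right_cancel h2

theorem geom_sum_eq_zero_of_pow_eq_one {x : F} (hx : x ^ M = 1) (hx1 : x ≠ 1) :
    ∑ a ∈ Finset.range M, x ^ a = 0 := by
  have := geom_sum_mul x M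
  rw [hx, sub_self, mul_eq_zero] at this
  exact this.resolve_right (sub_ne_zero.2 hx1)

theorem eigenproj_of_mem {v : V} (hv : v ∈ eigengroup Z θ) (hθ0 : θ ≠ 0) :
    eigenproj Z M θ v = (M : F) • v := by
  rw [eigenproj_apply]
  simp only [pow_apply_of_mem_eigengroup hv, smul_smul]
  simp [hθ0, Nat.cast_smul_eq_nsmul]

theorem eigenproj_of_mem_of_ne {v : V} (hv : v ∈ eigengroup Z η) (hθη : Commute θ η)
    (hθ : θ ^ M = 1) (hη : η ^ M = 1) (hθ0 : θ ≠ 0) (hne : θ ≠ η) :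
    eigenproj Z M θ v = 0 := by
  rw [eigenproj_apply]
  have h1 : ∀ a, (θ ^ a)⁻¹ • (Z ^ a) v = (θ⁻¹ * η) ^ a • v := fun a => by
    rw [pow_apply_of_mem_eigengroup hv, smul_smul, hθη.inv_left₀.mul_pow, inv_pow]
  simp only [h1, ← Finset.sum_smul]
  rw [geom_sum_eq_zero_of_pow_eq_one, zero_smul]
  · rw [hθη.inv_left₀.mul_pow, inv_pow, hθ, hη, inv_one, one_mul]
  · intro h
    exact hne ((inv_mul_eq_one₀ hθ0).1 h)

theorem sum_eigenproj {ω : F} (hω : ω ^ M = 1) (hinj : ∀ i, ω ^ i = 1 → M ∣ i) (v : V) :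
    ∑ i : Fin M, eigenproj Z M (ω ^ (i : ℕ)) v = (M : F) • v := by
  simp only [eigenproj_apply]
  rw [Finset.sum_comm]
  simp only [← Finset.sum_smul]
  rcases M.eq_zero_or_pos with rfl | hM
  · simp
  rw [Finset.sum_eq_single_of_mem 0 (Finset.mem_range.2 hM)]
  · simp
  · intro a ha ha0
    rw [Finset.mem_range] at ha
    have h1 : ∀ i : Fin M, ((ω ^ (i : ℕ)) ^ a)⁻¹ = ((ω ^ a)⁻¹) ^ (i : ℕ) := fun i => by
      rw [inv_pow, ← pow_mul, ← pow_mul, mul_comm]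
    simp only [h1]
    rw [Fin.sum_univ_eq_sum_range (fun i => ((ω ^ a)⁻¹) ^ i) M,
      geom_sum_eq_zero_of_pow_eq_one, zero_smul]
    · rw [inv_pow, ← pow_mul, mul_comm, pow_mul, hω, one_pow, inv_one]
    · intro h
      exact ha0 (Nat.eq_zero_of_dvd_of_lt (hinj a (by simpa using h)) ha)

end Projection

variable {F V : Type*} [DivisionRing F] [AddCommGroup V] [Module F V]
  {ν : F → EReal} {d N s : ℕ} {ω ϖ : F} {Λ : ℝ → AddSubgroup V} {Z : Module.End F V}

theorem IsTameFrame.val_natCast_sub_one (hω : IsTameFrame ν d N ω ϖ s) (hν : IsDiscreteVal ν d) :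
    ν ((N - 1 : ℕ) : F) = 0 := by
  refine hν.map_eq_zero_of_sub_pos (y := -1) (by rw [hν.map_neg, hν.map_one]) ?_
  rw [Nat.cast_sub hω.one_lt.le, Nat.cast_one, sub_neg_eq_add, sub_add_cancel]
  exact hω.natCast_pos

theorem IsTameFrame.pow_pow_eq_one (hω : IsTameFrame ν d N ω ϖ s) (i : ℕ) :
    (ω ^ i) ^ (N - 1) = 1 := by
  rw [← pow_mul, mul_comm, pow_mul, hω.pow_eq_one, one_pow]

theorem eigenproj_mem_filtration (hω : IsTameFrame ν d N ω ϖ s) (hν : IsDiscreteVal ν d)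
    (hΛ : IsNormFiltration ν Λ) (hZ : HasShift Λ Z 0) (M i : ℕ) {t : ℝ} {v : V} (hv : v ∈ Λ t) :
    eigenproj Z M (ω ^ i) v ∈ Λ t := by
  rw [eigenproj_apply]
  refine sum_mem fun a _ => hΛ.smul_mem_of_nonneg
    (hν.map_inv_eq_zero (hν.map_pow_eq_zero (hν.map_pow_eq_zero hω.val_root i) a)).ge ?_
  have := (hZ.pow a t v).2 hv
  rwa [mul_zero, add_zero] at this

theorem eigenproj_mem_upper (hω : IsTameFrame ν d N ω ϖ s) (hν : IsDiscreteVal ν d)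
    (hΛ : IsNormFiltration ν Λ) (hZ : HasShift Λ Z 0) (M i : ℕ) {t : ℝ} {v : V}
    (hv : v ∈ upper Λ t) : eigenproj Z M (ω ^ i) v ∈ upper Λ t := by
  obtain ⟨r, hr, hv⟩ := hΛ.mem_upper.1 hv
  exact hΛ.mem_upper.2 ⟨r, hr, eigenproj_mem_filtration hω hν hΛ hZ M i hv⟩

/-- A residual basis of `Λ t` consisting of eigenvectors, with `n i` of them in the eigenspace of
`ω ^ i`. -/
structure IsEigenbasis (ν : F → EReal) (N : ℕ) (ω : F) (Z : Module.End F V)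
    (Λ : ℝ → AddSubgroup V) (t : ℝ) (n : Fin (N - 1) → ℕ) (b : ∀ i, Fin (n i) → V) : Prop where
  mem_eigengroup : ∀ (i : Fin (N - 1)) j, b i j ∈ eigengroup Z (ω ^ (i : ℕ))
  mem : ∀ i j, b i j ∈ Λ t
  resIndep : ResIndep ν Λ (fun p : Σ i, Fin (n i) => b p.1 p.2) (fun _ => t)
  span : ∀ v ∈ Λ t, ∃ c : (Σ i, Fin (n i)) → F, (∀ p, 0 ≤ ν (c p)) ∧
    v - ∑ p, c p • b p.1 p.2 ∈ upper Λ t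
  relIndex : ∀ i : Fin (N - 1), (upper Λ t).relIndex (eigengroup Z (ω ^ (i : ℕ)) ⊓ Λ t) = N ^ n i

theorem resIndep_sigma_eigen (hω : IsTameFrame ν d N ω ϖ s) (hν : IsDiscreteVal ν d)
    (hΛ : IsNormFiltration ν Λ) (hZ : HasShift Λ Z 0) {t : ℝ}
    {n : Fin (N - 1) → ℕ} {b : ∀ i, Fin (n i) → V}
    (hbZ : ∀ (i : Fin (N - 1)) j, b i j ∈ eigengroup Z (ω ^ (i : ℕ))) (hb : ∀ i j, b i j ∈ Λ t)
    (hind : ∀ i, ResIndep ν Λ (b i) (fun _ => t)) :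
    ResIndep ν Λ (fun p : Σ i, Fin (n i) => b p.1 p.2) (fun _ => t) := by
  rw [resIndep_const_iff hν]
  intro c hc hsum
  obtain ⟨S, hS, -, hSω⟩ := hω.exists_residueSystem hν
  choose y hy _ using fun p => hS.2 (c p) (hc p)
  have hcomm : ∀ p i, Commute (y p) (ω ^ i) := fun p i => by
    rcases hSω _ (hy p).1 with h | ⟨j, h⟩ <;> rw [h]
    · exact Commute.zero_left _
    · exact (Commute.refl ω).pow_pow j i
  let w : Fin (N - 1) → V := fun i => ∑ j, y ⟨i, j⟩ • b i j
  have hw : ∀ i : Fin (N - 1), w i ∈ eigengroup Z (ω ^ (i : ℕ)) := fun i =>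
    sum_mem fun j _ => smul_mem_eigengroup (hcomm _ _) (hbZ i j)
  have hwsum : ∑ i, w i ∈ upper Λ t := by
    have h1 : ∑ p : Σ i, Fin (n i), (c p - y p) • b p.1 p.2 ∈ upper Λ t :=
      sum_mem fun p _ => hΛ.smul_mem_upper_of_pos hν (hy p).2 (hb _ _)
    have h2 := sub_mem hsum h1
    rw [← Finset.sum_sub_distrib] at h2
    simp only [← sub_smul, sub_sub_cancel] at h2
    rwa [Fintype.sum_sigma] at h2
  have hwi : ∀ i, w i ∈ upper Λ t := fun i => by
    have h1 := eigenproj_mem_upper hω hν hΛ hZ (N - 1) i hwsum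
    rw [map_sum, Finset.sum_eq_single_of_mem i (Finset.mem_univ i), eigenproj_of_mem (hw i)
      (pow_ne_zero _ (hω.root_ne_zero hν))] at h1
    · have h2 := hω.val_natCast_sub_one hν
      have := hΛ.smul_upper_of_nonneg (hν.map_inv_eq_zero h2).ge h1
      rwa [inv_smul_smul₀ (hν.ne_zero_of_eq_coe (a := 0) (by simpa using h2))] at this
    · intro j _ hji
      refine eigenproj_of_mem_of_ne (hw j) ((Commute.refl ω).pow_pow _ _) (hω.pow_pow_eq_one _)
        (hω.pow_pow_eq_one _) (pow_ne_zero _ (hω.root_ne_zero hν)) fun h => hji ?_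
      exact Fin.ext (hω.pow_injOn hν i.2 j.2 h).symm
  rintro ⟨i, j⟩
  have h1 := (resIndep_const_iff hν).1 (hind i) (fun j => y ⟨i, j⟩)
    (fun j => hS.1 _ (hy _).1) (hwi i) j
  have h2 := hν.lt_add (hy ⟨i, j⟩).2 h1
  rwa [sub_add_cancel] at h2

theorem exists_isEigenbasis [Module.Finite F V] (hω : IsTameFrame ν d N ω ϖ s)
    (hν : IsDiscreteVal ν d) (hΛ : IsNormFiltration ν Λ) (hZ : HasShift Λ Z 0)
    (hZN : Z ^ (N - 1) = 1) (t : ℝ) :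
    ∃ (n : Fin (N - 1) → ℕ) (b : ∀ i, Fin (n i) → V), IsEigenbasis ν N ω Z Λ t n b := by
  obtain ⟨S, hS, hScard, hSω⟩ := hω.exists_residueSystem hν
  choose n b hb hind hspan using fun i : Fin (N - 1) =>
    hΛ.exists_residual_basis hν (eigengroup Z (ω ^ (i : ℕ)) ⊓ Λ t) t inf_le_right
  refine ⟨n, b, fun i j => (hb i j).1, fun i j => (hb i j).2,
    resIndep_sigma_eigen hω hν hΛ hZ (fun i j => (hb i j).1) (fun i j => (hb i j).2) hind,
    fun v hv => ?_, fun i => ?_⟩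
  · have hM := hω.val_natCast_sub_one hν
    have hM' := (hν.map_inv_eq_zero hM).ge
    choose c hc hcv using fun i : Fin (N - 1) => hspan i (eigenproj Z (N - 1) (ω ^ (i : ℕ)) v)
      ⟨eigenproj_mem hZN (hω.pow_pow_eq_one _) (pow_ne_zero _ (hω.root_ne_zero hν)) v,
        eigenproj_mem_filtration hω hν hΛ hZ _ _ hv⟩
    refine ⟨fun p => ((N - 1 : ℕ) : F)⁻¹ * c p.1 p.2, fun p => hν.mul_nonneg hM' (hc _ _), ?_⟩
    have h1 := hΛ.smul_upper_of_nonneg hM' (sum_mem fun i (_ : i ∈ Finset.univ) => hcv i)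
    rw [Finset.sum_sub_distrib, sum_eigenproj hω.pow_eq_one hω.dvd_of_pow_eq_one, smul_sub,
      inv_smul_smul₀ (hν.ne_zero_of_eq_coe (a := 0) (by simpa using hM))] at h1
    rw [Fintype.sum_sigma]
    simpa only [Finset.smul_sum, smul_smul] using h1
  · rw [hΛ.relIndex_upper hν hS inf_le_right (fun y hy v hv => ?_) (hb i) (hind i)
      (hspan i), Fintype.card_fin, hScard]
    refine ⟨smul_mem_eigengroup ?_ hv.1, hΛ.smul_mem_of_nonneg (hS.1 y hy) hv.2⟩
    rcases hSω y hy with h | ⟨j, h⟩ <;> rw [h]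
    · exact Commute.zero_left _
    · exact (Commute.refl ω).pow_pow _ _

theorem IsEigenbasis.relIndex_eq (hω : IsTameFrame ν d N ω ϖ s) (hν : IsDiscreteVal ν d)
    (hΛ : IsNormFiltration ν Λ) {t : ℝ} {n : Fin (N - 1) → ℕ} {b : ∀ i, Fin (n i) → V}
    (h : IsEigenbasis ν N ω Z Λ t n b) : (upper Λ t).relIndex (Λ t) = N ^ ∑ i, n i := by
  obtain ⟨S, hS, hScard, -⟩ := hω.exists_residueSystem hν
  have := hΛ.relIndex_upper hν hS le_rfl
    (fun y hy v hv => hΛ.smul_mem_of_nonneg (hS.1 y hy) hv)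
    (b := fun p : Σ i, Fin (n i) => b p.1 p.2) (fun p => h.mem p.1 p.2) h.resIndep h.span
  rw [this, hScard, Fintype.card_sigma]
  simp only [Fintype.card_fin]

end Eigenspaces

section Orbit

open Polynomial in
theorem SemiconjBy.aeval {k F : Type*} [CommSemiring k] [Semiring F] [Algebra k F] {a x y : F}
    (h : SemiconjBy a x y) (p : k[X]) :
    SemiconjBy a (Polynomial.aeval x p) (Polynomial.aeval y p) := by
  induction p using Polynomial.induction_on' with
  | add p q hp hq => simpa only [map_add] using hp.add_right hq
  | monomial n c =>
    simpa only [aeval_monomial] using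
      SemiconjBy.mul_right (Algebra.commute_algebraMap_right c a) (h.pow_right n)

theorem IsTameFrame.unif_mul_pow {F : Type*} [DivisionRing F] {ν : F → EReal} {d N s : ℕ}
    {ω ϖ : F} (hω : IsTameFrame ν d N ω ϖ s) (n : ℕ) : ϖ * ω ^ n = ω ^ (s * n) * ϖ := by
  rw [pow_mul]
  exact SemiconjBy.pow_right hω.unif_mul n

open Polynomial in
/-- If conjugation by a uniformizer permutes the powers `ω ^ (i * s ^ a)`, `a < r`, cyclically, they
are the roots of a monic polynomial with central coefficients. -/
theorem IsTameFrame.exists_orbit_polynomial {k F : Type*} [Field k] [DivisionRing F] [Algebra k F]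
    [Module.Finite k F] {νk : k → EReal} {ν : F → EReal} {d N s q : ℕ} {ω ϖ : F}
    (hk : IsLocalValuation k νk 1 q) (hω : IsTameFrame ν d N ω ϖ s) (hν : IsDiscreteVal ν d)
    (hcF : ∀ c : k, ν (algebraMap k F c) = νk c)
    (hcentral : ∀ z : F, (∀ w, Commute z w) → ∃ c : k, algebraMap k F c = z) (i : ℕ) {r : ℕ}
    (hr : 0 < r) (hper : ω ^ (i * s ^ r) = ω ^ i) :
    ∃ p : k[X], p.Monic ∧ p.natDegree = r ∧
      ∀ j : ℕ, aeval (ω ^ j) p = 0 ↔ ∃ a < r, ω ^ j = ω ^ (i * s ^ a) := by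
  let φ : k[X] →ₐ[k] F := aeval ω
  let τ : k[X] →ₐ[k] k[X] := aeval (X ^ s)
  have hφX : ∀ n, φ (X ^ n) = ω ^ n := fun n => by simp [φ]
  have hconj : ∀ b : k[X], ϖ * φ b = φ (τ b) * ϖ := fun b => by
    have h1 : φ (τ b) = aeval (ω ^ s) b := by
      rw [← aeval_algHom_apply φ, hφX]
    rw [h1]
    exact SemiconjBy.aeval hω.unif_mul b
  let f : ℕ → k[X][X] := fun a => X - C (X ^ (i * s ^ a))
  let g : k[X][X] := ∏ a ∈ Finset.range r, f a
  have hgm : g.Monic := monic_prod_X_sub_C _ _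
  have hgdeg : g.natDegree = r :=
    (natDegree_finsetProd_X_sub_C_eq_card _ _).trans (Finset.card_range r)
  have hgτ : mapRingHom (φ : k[X] →+* F) (mapRingHom (τ : k[X] →+* k[X]) g)
      = mapRingHom (φ : k[X] →+* F) g := by
    have h1 : mapRingHom (τ : k[X] →+* k[X]) g = ∏ a ∈ Finset.range r, f (a + 1) := by
      rw [map_prod]
      refine Finset.prod_congr rfl fun a _ => ?_
      simp [f, τ, ← pow_mul, pow_succ', mul_left_comm]
    obtain ⟨r, rfl⟩ := Nat.exists_eq_add_one_of_ne_zero hr.ne'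
    rw [h1, Finset.prod_range_succ, map_mul]
    simp only [g]
    rw [Finset.prod_range_succ', map_mul]
    congr 1
    simp only [f, coe_mapRingHom, Polynomial.map_sub, map_X, map_C, RingHom.coe_coe, hφX, hper]
    simp
  have hcoef : ∀ n, ∃ c : k, algebraMap k F c = φ (g.coeff n) := fun n => by
    refine hcentral _ fun w => hω.commute_all hk hν hcF ?_ ?_ w
    · have h1 := hφX 1
      rw [pow_one, pow_one] at h1
      rw [← h1, Commute, SemiconjBy, ← map_mul, ← map_mul, mul_comm]
    · have h1 := congrArg (fun p : F[X] => p.coeff n) hgτ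
      simp only [coe_mapRingHom, coeff_map, RingHom.coe_coe] at h1
      rw [Commute, SemiconjBy, hconj, h1]
  obtain ⟨p, hp, hpdeg, hpm⟩ := lifts_and_natDegree_eq_and_monic (f := algebraMap k F)
    (p := g.map (φ : k[X] →+* F)) ((lifts_iff_coeff_lifts _).2 fun n => by
      rw [coeff_map]
      exact hcoef n) (hgm.map _)
  refine ⟨p, hpm, by rw [hpdeg, hgm.natDegree_map, hgdeg], fun j => ?_⟩
  have h1 : aeval (ω ^ j) p = φ (g.eval (X ^ j)) := by
    rw [aeval_def, eval₂_eq_eval_map, hp, ← eval₂_eq_eval_map, ← hφX]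
    exact eval₂_at_apply (φ : k[X] →+* F) (X ^ j)
  have h2 := (RingHom.ker_isPrime (φ : k[X] →+* F)).prod_mem_iff (s := Finset.range r)
    (x := fun a => (f a).eval (X ^ j))
  rw [RingHom.mem_ker, ← eval_prod] at h2
  rw [h1]
  refine h2.trans (exists_congr fun a => ?_)
  rw [Finset.mem_range, RingHom.mem_ker]
  refine and_congr_right fun _ => ?_
  simp only [f, eval_sub, eval_X, eval_C, RingHom.coe_coe, map_sub, hφX, sub_eq_zero]

variable {k E F V : Type*} [Field k] [Field E] [Algebra k E]
  [DivisionRing F] [Algebra k F] [AddCommGroup V] [Module F V]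

open Polynomial in
theorem aeval_apply_of_mem_eigengroup (ρ : E →+* Module.End F V)
    (hρ : ∀ c v, ρ (algebraMap k E c) v = algebraMap k F c • v) {ζ : E} {θ : F} {v : V}
    (hv : v ∈ eigengroup (ρ ζ) θ) (p : k[X]) : ρ (aeval ζ p) v = aeval θ p • v := by
  induction p using Polynomial.induction_on' with
  | add p q hp hq => simp only [map_add, LinearMap.add_apply, hp, hq, add_smul]
  | monomial n c =>
    rw [aeval_monomial, aeval_monomial, map_mul, map_pow, Module.End.mul_apply, hρ,
      pow_apply_of_mem_eigengroup hv, smul_smul]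

open Polynomial in
theorem aeval_eq_zero_iff_of_mem_eigengroup (ρ : E →+* Module.End F V)
    (hρ : ∀ c v, ρ (algebraMap k E c) v = algebraMap k F c • v) {ζ : E} {θ : F}
    (hθ : eigengroup (ρ ζ) θ ≠ ⊥) (p : k[X]) : aeval ζ p = 0 ↔ aeval θ p = 0 := by
  obtain ⟨v, hv, hv0⟩ := (AddSubgroup.bot_or_exists_ne_zero _).resolve_left hθ
  have h1 := aeval_apply_of_mem_eigengroup ρ hρ hv p
  constructor
  · intro h
    rw [h, map_zero, LinearMap.zero_apply] at h1
    exact (smul_eq_zero.1 h1.symm).resolve_right hv0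
  · intro h
    by_contra hne
    rw [h, zero_smul] at h1
    have h2 := congrArg (ρ (aeval ζ p)⁻¹) h1
    rw [← Module.End.mul_apply, ← map_mul, inv_mul_cancel₀ hne, map_one, map_zero] at h2
    exact hv0 h2

open Polynomial in
/-- The eigenvalues of an element `ζ` of `E` form a single orbit under conjugation by the
uniformizer, whose length is the degree of `ζ`. -/
theorem eigenvalues_orbit [FiniteDimensional k E] [Module.Finite k F]
    {νk : k → EReal} {ν : F → EReal} {d N s q : ℕ} {ω ϖ : F}
    (hk : IsLocalValuation k νk 1 q) (hω : IsTameFrame ν d N ω ϖ s) (hν : IsDiscreteVal ν d)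
    (hcF : ∀ c : k, ν (algebraMap k F c) = νk c)
    (hcentral : ∀ z : F, (∀ w, Commute z w) → ∃ c : k, algebraMap k F c = z)
    (ρ : E →+* Module.End F V)
    (hρ : ∀ c v, ρ (algebraMap k E c) v = algebraMap k F c • v) {ζ : E} {i : ℕ}
    (hi : eigengroup (ρ ζ) (ω ^ i) ≠ ⊥) :
    ω ^ (i * s ^ (minpoly k ζ).natDegree) = ω ^ i ∧
      ∀ j, eigengroup (ρ ζ) (ω ^ j) ≠ ⊥ → ∃ a, ω ^ j = ω ^ (i * s ^ a) := by
  classical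
  have hϖ0 := hω.unif_ne_zero hν
  have hconj : ∀ n : ℕ, ϖ * ω ^ n * ϖ⁻¹ = ω ^ (s * n) := fun n => by
    rw [mul_inv_eq_iff_eq_mul₀ hϖ0, hω.unif_mul_pow]
  let σ : F → F := fun x => ϖ * x * ϖ⁻¹
  have hσinj : Function.Injective σ := fun x y hxy =>
    mul_left_cancel₀ hϖ0 (mul_right_cancel₀ (inv_ne_zero hϖ0) hxy)
  have hσ : ∀ a, σ^[a] (ω ^ i) = ω ^ (i * s ^ a) := fun a => by
    induction a with
    | zero => simp
    | succ a ih =>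
      rw [Function.iterate_succ_apply', ih, pow_succ' s, mul_left_comm, ← hconj]
  have hper : ω ^ i ∈ Function.periodicPts σ := by
    have hN : 0 < N - 1 := Nat.sub_pos_of_lt hω.one_lt
    obtain ⟨a, b, hab, h⟩ := Finite.exists_ne_map_eq_of_infinite
      fun a : ℕ => (⟨(i * s ^ a) % (N - 1), Nat.mod_lt _ hN⟩ : Fin (N - 1))
    have h1 : σ^[a] (ω ^ i) = σ^[b] (ω ^ i) := by
      rw [hσ, hσ, ← hω.pow_mod, Fin.mk.inj h, hω.pow_mod]
    wlog hlt : a < b generalizing a b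
    · exact this b a hab.symm h.symm h1.symm (by omega)
    refine Function.mk_mem_periodicPts (n := b - a) (by omega) ?_
    refine (hσinj.iterate a ?_).symm
    rw [← Function.iterate_add_apply, Nat.add_sub_cancel' hlt.le, h1]
  set r := Function.minimalPeriod σ (ω ^ i) with hr
  have hr0 : 0 < r := Function.minimalPeriod_pos_of_mem_periodicPts hper
  have hrper : ω ^ (i * s ^ r) = ω ^ i := by
    rw [← hσ]
    exact Function.isPeriodicPt_minimalPeriod σ (ω ^ i)
  obtain ⟨p, hpm, hpdeg, hp⟩ := hω.exists_orbit_polynomial hk hν hcF hcentral i hr0 hrper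
  have hpζ : aeval ζ p = 0 :=
    (aeval_eq_zero_iff_of_mem_eigengroup ρ hρ hi p).2 ((hp i).2 ⟨0, hr0, by simp⟩)
  have hζint : IsIntegral k ζ := IsIntegral.of_finite k ζ
  have hle : (minpoly k ζ).natDegree ≤ r := by
    rw [← hpdeg]
    exact natDegree_le_natDegree (minpoly.min k ζ hpm hpζ)
  have hpow : ∀ a b : ℕ, (ω ^ i) ^ a = (ω ^ i) ^ b ↔ ζ ^ a = ζ ^ b := fun a b => by
    have := aeval_eq_zero_iff_of_mem_eigengroup ρ hρ hi (X ^ a - X ^ b : k[X])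
    simpa [sub_eq_zero] using this.symm
  have hroot : ∀ a, aeval (σ^[a] (ω ^ i)) (minpoly k ζ) = 0 := fun a => by
    induction a with
    | zero => exact (aeval_eq_zero_iff_of_mem_eigengroup ρ hρ hi _).1 (minpoly.aeval k ζ)
    | succ a ih =>
      rw [Function.iterate_succ_apply']
      have h1 : SemiconjBy ϖ (σ^[a] (ω ^ i)) (σ (σ^[a] (ω ^ i))) :=
        (inv_mul_cancel_right₀ hϖ0 _).symm
      have h2 := h1.aeval (minpoly k ζ)
      rw [ih, SemiconjBy, mul_zero, eq_comm, mul_eq_zero] at h2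
      exact h2.resolve_right hϖ0
  have hge : r ≤ (minpoly k ζ).natDegree := by
    have hinj : Set.InjOn (fun a => ζ ^ (s ^ a)) (Finset.range r : Set ℕ) := by
      intro a ha b hb hab
      rw [Finset.coe_range] at ha hb
      refine Function.iterate_injOn_Iio_minimalPeriod ha hb ?_
      have := (hpow _ _).2 hab
      simpa only [hσ, pow_mul] using this
    have h1 := card_le_degree_of_subset_roots (p := (minpoly k ζ).map (algebraMap k E))
      (Z := (Finset.range r).image fun a => ζ ^ (s ^ a)) (by
        intro x hx
        rw [Finset.mem_val] at hx
        obtain ⟨a, -, rfl⟩ := Finset.mem_image.1 hx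
        rw [mem_roots ((minpoly.monic hζint).map _).ne_zero, IsRoot.def, eval_map_algebraMap]
        have h2 := (aeval_eq_zero_iff_of_mem_eigengroup ρ hρ hi
          ((minpoly k ζ).comp (X ^ (s ^ a)))).2 (by
            have := hroot a
            rw [hσ, pow_mul] at this
            simpa [aeval_comp] using this)
        simpa [aeval_comp] using h2)
    rwa [Finset.card_image_of_injOn hinj, Finset.card_range, (minpoly.monic hζint).natDegree_map]
      at h1
  have hm : (minpoly k ζ).natDegree = r := le_antisymm hle hge
  refine ⟨by rw [hm, hrper], fun j hj => ?_⟩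
  obtain ⟨a, -, ha⟩ := (hp j).1 ((aeval_eq_zero_iff_of_mem_eigengroup ρ hρ hj p).1 hpζ)
  exact ⟨a, ha⟩

end Orbit

section Counting

theorem AddSubgroup.relIndex_eq_of_addEquiv {V : Type*} [AddCommGroup V] (φ : V ≃+ V)
    {A B A' B' : AddSubgroup V} (hA : ∀ v, φ v ∈ A' ↔ v ∈ A) (hB : ∀ v, φ v ∈ B' ↔ v ∈ B) :
    A'.relIndex B' = A.relIndex B := by
  have key : ∀ {A A' : AddSubgroup V}, (∀ v, φ v ∈ A' ↔ v ∈ A) → A.map φ.toAddMonoidHom = A' := by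
    intro A A' h
    ext w
    obtain ⟨v, rfl⟩ := φ.surjective w
    rw [h]
    exact ⟨fun ⟨u, hu, huv⟩ => φ.injective huv ▸ hu, fun hv => ⟨v, hv, rfl⟩⟩
  rw [← key hA, ← key hB]
  exact AddSubgroup.relIndex_map_map_of_injective _ _ φ.injective

variable {F V : Type*} [DivisionRing F] [AddCommGroup V] [Module F V]
  {ν : F → EReal} {d N s : ℕ} {ω ϖ : F} {Λ : ℝ → AddSubgroup V} {Z : Module.End F V}

/-- The cardinality of the `θ`-eigenspace of the graded piece of degree `t`. -/
def eigencount (Λ : ℝ → AddSubgroup V) (Z : Module.End F V) (θ : F) (t : ℝ) : ℕ :=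
  (upper Λ t).relIndex (eigengroup Z θ ⊓ Λ t)

theorem eigencount_eq_of_hasShift {ν : F → EReal} (hΛ : IsNormFiltration ν Λ)
    {A B : Module.End F V} {a : ℝ} (hA : HasShift Λ A a) (hAB : A * B = 1) (hBA : B * A = 1)
    (hAZ : Commute A Z) (θ : F) (t : ℝ) :
    eigencount Λ Z θ (t + a) = eigencount Λ Z θ t := by
  have hBA' : ∀ v, B (A v) = v := fun v => by
    rw [← Module.End.mul_apply, hBA, Module.End.one_apply]
  have hAB' : ∀ v, A (B v) = v := fun v => by
    rw [← Module.End.mul_apply, hAB, Module.End.one_apply]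
  let φ : V ≃+ V := { A.toAddMonoidHom with invFun := B, left_inv := hBA', right_inv := hAB' }
  refine AddSubgroup.relIndex_eq_of_addEquiv φ (fun v => hA.mem_upper_iff hΛ t v)
    fun v => and_congr ?_ (hA t v)
  change Z (A v) = θ • A v ↔ Z v = θ • v
  rw [← Module.End.mul_apply, ← hAZ.eq, Module.End.mul_apply, ← map_smul]
  exact φ.injective.eq_iff

theorem eigencount_unif (hω : IsTameFrame ν d N ω ϖ s) (hν : IsDiscreteVal ν d)
    (hΛ : IsNormFiltration ν Λ) (i : ℕ) (t : ℝ) :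
    eigencount Λ Z (ω ^ (s * i)) (t + (d : ℝ)⁻¹) = eigencount Λ Z (ω ^ i) t := by
  have hϖ0 := hω.unif_ne_zero hν
  refine AddSubgroup.relIndex_eq_of_addEquiv (DistribMulAction.toAddEquiv₀ V ϖ hϖ0)
    (fun v => hΛ.smul_mem_upper_iff hν hω.val_unif)
    fun v => and_congr ?_ (hΛ.smul_mem_iff hν hω.val_unif)
  change Z (ϖ • v) = ω ^ (s * i) • ϖ • v ↔ Z v = ω ^ i • v
  rw [map_smul, smul_smul, ← hω.unif_mul_pow, ← smul_smul]
  exact (smul_right_injective V hϖ0).eq_iff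

theorem eigencount_unif_pow (hω : IsTameFrame ν d N ω ϖ s) (hν : IsDiscreteVal ν d)
    (hΛ : IsNormFiltration ν Λ) (i a : ℕ) (t : ℝ) :
    eigencount Λ Z (ω ^ (i * s ^ a)) (t + a / d) = eigencount Λ Z (ω ^ i) t := by
  induction a with
  | zero => simp
  | succ a ih =>
    have ht : t + (a + 1 : ℕ) / d = t + a / d + (d : ℝ)⁻¹ := by
      push_cast
      ring
    rw [← ih, ← eigencount_unif hω hν hΛ (i * s ^ a), ht, pow_succ, ← mul_assoc, mul_comm _ s]

theorem add_int_mul_of_periodic {α : Type*} {c : ℝ → α} {a : ℝ} (h : ∀ t, c (t + a) = c t) (n : ℤ)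
    (t : ℝ) : c (t + n * a) = c t := by
  have := (show Function.Periodic c a from h).int_mul n t
  exact this

variable {k E : Type*} [Field k] [Field E] [Algebra k E] [FiniteDimensional k E]
  [Algebra k F] [Module.Finite k F]

/-- The graded multiplicity of an eigenvalue does not depend on the eigenvalue. -/
theorem eigencount_eq {νk : k → EReal} {νE : E → EReal} {e q : ℕ}
    (hk : IsLocalValuation k νk 1 q)
    (hE : IsDiscreteVal νE e) (hcE : ∀ c : k, νE (algebraMap k E c) = νk c)
    (hν : IsDiscreteVal ν d) (hω : IsTameFrame ν d N ω ϖ s)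
    (hcF : ∀ c : k, ν (algebraMap k F c) = νk c)
    (hcentral : ∀ z : F, (∀ w, Commute z w) → ∃ c : k, algebraMap k F c = z)
    (hΛ : IsNormFiltration ν Λ)
    (ρ : E →+* Module.End F V) (hρ : ∀ c v, ρ (algebraMap k E c) v = algebraMap k F c • v)
    (hΛE : ∀ x : E, x ≠ 0 → ∃ s, HasShift Λ (ρ x) s) {ζ : E}
    (hab : ∃ a b : ℤ, a * d + b * ((minpoly k ζ).natDegree * e) = (e : ℤ)) {i j : ℕ}
    (hi : eigengroup (ρ ζ) (ω ^ i) ≠ ⊥) (hj : eigengroup (ρ ζ) (ω ^ j) ≠ ⊥) (t : ℝ) :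
    eigencount Λ (ρ ζ) (ω ^ j) t = eigencount Λ (ρ ζ) (ω ^ i) t := by
  have hd : (d : ℝ) ≠ 0 := by exact_mod_cast hν.e_pos.ne'
  have he : (e : ℝ) ≠ 0 := by exact_mod_cast hE.e_pos.ne'
  obtain ⟨hm, horb⟩ := eigenvalues_orbit hk hω hν hcF hcentral ρ hρ hi
  set m := (minpoly k ζ).natDegree
  obtain ⟨x, hx⟩ := hE.exists_uniformizer
  have hx0 := hE.ne_zero_of_eq_coe hx
  have h1 : ∀ t, eigencount Λ (ρ ζ) (ω ^ i) (t + (e : ℝ)⁻¹) = eigencount Λ (ρ ζ) (ω ^ i) t :=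
    eigencount_eq_of_hasShift hΛ (hasShift_of_val_eq hk hE hcE hν hcF hΛ ρ hρ hΛE hx)
      (B := ρ x⁻¹) (by rw [← map_mul, mul_inv_cancel₀ hx0, map_one])
      (by rw [← map_mul, inv_mul_cancel₀ hx0, map_one]) ((Commute.all x ζ).map ρ) _
  have h2 : ∀ t, eigencount Λ (ρ ζ) (ω ^ i) (t + m / d) = eigencount Λ (ρ ζ) (ω ^ i) t :=
    fun t => by
      rw [← eigencount_unif_pow hω hν hΛ i m t, hm]
  have h3 : ∀ t, eigencount Λ (ρ ζ) (ω ^ i) (t + (d : ℝ)⁻¹) = eigencount Λ (ρ ζ) (ω ^ i) t :=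
    fun t => by
      obtain ⟨a, b, hab⟩ := hab
      have hab' : (a * d + b * (m * e) : ℝ) = e := by exact_mod_cast hab
      rw [← add_int_mul_of_periodic h2 b t, ← add_int_mul_of_periodic h1 a (t + b * _)]
      congr 1
      field_simp
      linear_combination -hab'
  obtain ⟨a, ha⟩ := horb j hj
  have h4 := eigencount_unif_pow (Z := ρ ζ) hω hν hΛ i a (t - a / d)
  rw [sub_add_cancel, ← ha] at h4
  have h5 := add_int_mul_of_periodic h3 a (t - a / d)
  rw [Int.cast_natCast, ← div_eq_mul_inv, sub_add_cancel] at h5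
  rw [h4, h5]

/-- The multiplicities of an eigenbasis are determined by the cardinality of the graded piece. -/
theorem IsEigenbasis.mult_eq {Λ' : ℝ → AddSubgroup V} (hω : IsTameFrame ν d N ω ϖ s)
    (hν : IsDiscreteVal ν d) (hΛ : IsNormFiltration ν Λ) (hΛ' : IsNormFiltration ν Λ') {t : ℝ}
    (hconst : ∀ i j : ℕ, eigengroup Z (ω ^ i) ≠ ⊥ → eigengroup Z (ω ^ j) ≠ ⊥ →
      eigencount Λ Z (ω ^ j) t = eigencount Λ Z (ω ^ i) t)
    (hconst' : ∀ i j : ℕ, eigengroup Z (ω ^ i) ≠ ⊥ → eigengroup Z (ω ^ j) ≠ ⊥ →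
      eigencount Λ' Z (ω ^ j) t = eigencount Λ' Z (ω ^ i) t)
    (htot : (upper Λ t).relIndex (Λ t) = (upper Λ' t).relIndex (Λ' t))
    {n n' : Fin (N - 1) → ℕ} {b : ∀ i, Fin (n i) → V} {b' : ∀ i, Fin (n' i) → V}
    (h : IsEigenbasis ν N ω Z Λ t n b) (h' : IsEigenbasis ν N ω Z Λ' t n' b') : n = n' := by
  classical
  have hinj := Nat.pow_right_injective hω.one_lt
  have hzero : ∀ {Λ : ℝ → AddSubgroup V} {n : Fin (N - 1) → ℕ} {b : ∀ i, Fin (n i) → V},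
      IsEigenbasis ν N ω Z Λ t n b → ∀ i : Fin (N - 1), eigengroup Z (ω ^ (i : ℕ)) = ⊥ →
        n i = 0 := by
    intro Λ n b h i hi
    have h1 := h.relIndex i
    rw [hi, bot_inf_eq, AddSubgroup.relIndex_bot_right] at h1
    exact hinj (by simpa using h1.symm)
  have hsum : ∑ i, n i = ∑ i, n' i := by
    rw [h.relIndex_eq hω hν hΛ, h'.relIndex_eq hω hν hΛ'] at htot
    exact hinj htot
  have hcon : ∀ {Λ : ℝ → AddSubgroup V} {n : Fin (N - 1) → ℕ} {b : ∀ i, Fin (n i) → V},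
      IsEigenbasis ν N ω Z Λ t n b →
      (∀ i j : ℕ, eigengroup Z (ω ^ i) ≠ ⊥ → eigengroup Z (ω ^ j) ≠ ⊥ →
        eigencount Λ Z (ω ^ j) t = eigencount Λ Z (ω ^ i) t) →
      ∀ i j : Fin (N - 1), eigengroup Z (ω ^ (i : ℕ)) ≠ ⊥ → eigengroup Z (ω ^ (j : ℕ)) ≠ ⊥ →
        n j = n i := by
    intro Λ n b h hconst i j hi hj
    refine hinj ?_
    have := hconst i j hi hj
    rw [eigencount, eigencount, h.relIndex, h.relIndex] at this
    exact this
  funext i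
  by_cases hi : eigengroup Z (ω ^ (i : ℕ)) = ⊥
  · rw [hzero h i hi, hzero h' i hi]
  let R : Finset (Fin (N - 1)) := Finset.univ.filter fun j => eigengroup Z (ω ^ (j : ℕ)) ≠ ⊥
  have hR : ∀ {Λ : ℝ → AddSubgroup V} {n : Fin (N - 1) → ℕ} {b : ∀ i, Fin (n i) → V},
      IsEigenbasis ν N ω Z Λ t n b →
      (∀ i j : Fin (N - 1), eigengroup Z (ω ^ (i : ℕ)) ≠ ⊥ → eigengroup Z (ω ^ (j : ℕ)) ≠ ⊥ →
        n j = n i) → ∑ j, n j = R.card * n i := by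
    intro Λ n b h hn
    rw [← smul_eq_mul, ← Finset.sum_const, Finset.sum_filter]
    refine Finset.sum_congr rfl fun j _ => ?_
    split_ifs with hj
    · exact hn i j hi hj
    · exact hzero h j (not_not.1 hj)
  rw [hR h (hcon h hconst), hR h' (hcon h' hconst')] at hsum
  exact Nat.eq_of_mul_eq_mul_left (Finset.card_pos.2 ⟨i, by simpa [R] using hi⟩) hsum

end Counting

section Conjugation

variable {F V : Type*} [DivisionRing F] [AddCommGroup V] [Module F V] [Module.Finite F V]
  {ν : F → EReal} {d : ℕ} {Λ : ℝ → AddSubgroup V}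

/-- There is a finite system of representatives of the degrees of a filtration modulo the value
group. -/
theorem IsNormFiltration.exists_degree_reps (hν : IsDiscreteVal ν d)
    (hΛ : IsNormFiltration ν Λ) :
    ∃ T : Finset ℝ, (∀ (r s : T) (n : ℤ), (r : ℝ) = s + n / d → r = s) ∧
      ∀ (t : ℝ) (v : V), v ∈ Λ t → v ∉ upper Λ t → ∃ r ∈ T, ∃ n : ℤ, t = r + n / d := by
  classical
  let P : Finset ℝ → Prop := fun T =>
    (∀ r ∈ T, ∃ v, v ∈ Λ r ∧ v ∉ upper Λ r) ∧
      ∀ r ∈ T, ∀ s ∈ T, ∀ n : ℤ, r = s + n / d → r = s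
  have hcard : ∀ T, P T → T.card ≤ Module.finrank F V := by
    rintro T ⟨hv, hT⟩
    choose! v hv hvu using hv
    have hli := hΛ.linearIndependent_sigma hν (T := T) (ι := fun _ => Unit)
      (b := fun r _ => v r) (fun r _ => hv r r.2) (fun r => ?_)
      (fun r s n h => Subtype.ext (hT r r.2 s s.2 n h))
    · have := hli.fintype_card_le_finrank
      simpa using this
    · rw [resIndep_const_iff hν]
      intro c hc hsum j
      rw [Fintype.sum_unique] at hsum
      refine (hc j).lt_of_ne fun h0 => hvu r r.2 ?_
      have h1 : ν (c default) = ((0 : ℝ) : EReal) := h0.symm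
      have := hΛ.smul_mem_upper_iff hν h1 (t := r) (v := v r)
      rw [add_zero] at this
      exact this.1 hsum
  obtain ⟨T, hT, hTn⟩ := Nat.findGreatest_spec (P := fun n => ∃ T, P T ∧ T.card = n)
    (Nat.zero_le (Module.finrank F V)) ⟨∅, by simp [P], rfl⟩
  refine ⟨T, fun r s n h => Subtype.ext (hT.2 r r.2 s s.2 n h), fun t v hv hvu => ?_⟩
  by_contra! hcon
  have htT : t ∉ T := fun h => hcon t h 0 (by simp)
  have hP : P (insert t T) := by
    constructor
    · intro r hr
      rcases Finset.mem_insert.1 hr with rfl | hr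
      · exact ⟨v, hv, hvu⟩
      · exact hT.1 r hr
    · intro r hr s hs n h
      rcases Finset.mem_insert.1 hr with hr | hr <;> rcases Finset.mem_insert.1 hs with hs | hs
      · rw [hr, hs]
      · exact absurd (hr ▸ h) (hcon s hs n)
      · refine absurd ?_ (hcon r hr (-n))
        rw [← hs, h]
        push_cast
        ring
      · exact hT.2 r hr s hs n h
  have := Nat.le_findGreatest (P := fun n => ∃ T, P T ∧ T.card = n) (hcard _ hP) ⟨_, hP, rfl⟩
  rw [Finset.card_insert_of_notMem htT] at this
  omega

variable {N s : ℕ} {ω ϖ : F} {Λ' : ℝ → AddSubgroup V} {Z : Module.End F V}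

/-- Conjugate filtrations on which the eigenvalues of `Z` have constant graded multiplicities are
conjugate by an automorphism commuting with `Z`. -/
theorem exists_commuting_equiv (hω : IsTameFrame ν d N ω ϖ s) (hν : IsDiscreteVal ν d)
    (hcomp : ValComplete ν) (hΛ : IsNormFiltration ν Λ) (hΛ' : IsNormFiltration ν Λ')
    (hZ : HasShift Λ Z 0) (hZ' : HasShift Λ' Z 0) (hZN : Z ^ (N - 1) = 1)
    (hconst : ∀ t (i j : ℕ), eigengroup Z (ω ^ i) ≠ ⊥ → eigengroup Z (ω ^ j) ≠ ⊥ →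
      eigencount Λ Z (ω ^ j) t = eigencount Λ Z (ω ^ i) t)
    (hconst' : ∀ t (i j : ℕ), eigengroup Z (ω ^ i) ≠ ⊥ → eigengroup Z (ω ^ j) ≠ ⊥ →
      eigencount Λ' Z (ω ^ j) t = eigencount Λ' Z (ω ^ i) t)
    (g : V ≃+ V) (hg : ∀ t v, g v ∈ Λ' t ↔ v ∈ Λ t) :
    ∃ gt : V ≃ₗ[F] V, (∀ v, gt (Z v) = Z (gt v)) ∧ ∀ t v, gt v ∈ Λ' t ↔ v ∈ Λ t := by
  have hgu : ∀ t v, g v ∈ upper Λ' t ↔ v ∈ upper Λ t := fun t v => by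
    simp only [hΛ.mem_upper, hΛ'.mem_upper, hg]
  obtain ⟨T, hT, H2⟩ := hΛ.exists_degree_reps hν
  have H2' : ∀ (t : ℝ) (v : V), v ∈ Λ' t → v ∉ upper Λ' t → ∃ r ∈ T, ∃ n : ℤ, t = r + n / d := by
    intro t v hv hvu
    obtain ⟨u, rfl⟩ := g.surjective v
    exact H2 t u ((hg t u).1 hv) fun h => hvu ((hgu t u).2 h)
  choose n b hb using fun r : T => exists_isEigenbasis hω hν hΛ hZ hZN r
  choose n' b' hb' using fun r : T => exists_isEigenbasis hω hν hΛ' hZ' hZN r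
  obtain rfl : n = n' := funext fun r => (hb r).mult_eq hω hν hΛ hΛ' (hconst r) (hconst' r)
    (AddSubgroup.relIndex_eq_of_addEquiv g (hgu r) (hg r)).symm (hb' r)
  have key : ∀ {Λ : ℝ → AddSubgroup V} {b : ∀ (r : T) i, Fin (n r i) → V},
      IsNormFiltration ν Λ → (∀ r : T, IsEigenbasis ν N ω Z Λ r (n r) (b r)) →
      (∀ (t : ℝ) (v : V), v ∈ Λ t → v ∉ upper Λ t → ∃ r ∈ T, ∃ n : ℤ, t = r + n / d) →
      ∃ β : Module.Basis (Σ r : T, Σ i, Fin (n r i)) F V,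
        (∀ p, Z (β p) = ω ^ (p.2.1 : ℕ) • β p) ∧
        ∀ (c : (Σ r : T, Σ i, Fin (n r i)) → F) (t : ℝ),
          ∑ p, c p • β p ∈ Λ t ↔ ∀ p, ((t - p.1 : ℝ) : EReal) ≤ ν (c p) := by
    intro Λ b hΛ hb H2
    let B : ∀ r : T, (Σ i, Fin (n r i)) → V := fun r p => b r p.1 p.2
    have hB : ∀ (r : T) p, B r p ∈ Λ r := fun r p => (hb r).mem p.1 p.2
    have hBind : ∀ r : T, ResIndep ν Λ (B r) (fun _ => (r : ℝ)) := fun r => (hb r).resIndep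
    have hsp : ⊤ ≤ Submodule.span F (Set.range fun p : Σ r : T, Σ i, Fin (n r i) => B p.1 p.2) := by
      intro v _
      obtain ⟨t, ht⟩ := hΛ.exhaust v
      obtain ⟨c, -, hc⟩ := hΛ.exists_repr_sigma hν hcomp hB ⊤ (fun _ _ => trivial)
        (fun r v _ hv => (hb r).span v hv) (fun t v _ => H2 t v) trivial ht
      rw [hc]
      exact sum_mem fun p _ => Submodule.smul_mem _ _ (Submodule.subset_span ⟨p, rfl⟩)
    refine ⟨Module.Basis.mk (hΛ.linearIndependent_sigma hν hB hBind hT) hsp, fun p => ?_,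
      fun c t => ?_⟩
    · rw [Module.Basis.mk_apply]
      exact (hb p.1).mem_eigengroup p.2.1 p.2.2
    · simp only [Module.Basis.mk_apply]
      exact hΛ.sum_sigma_mem_iff hν hB hBind hT c t
  obtain ⟨β, hβZ, hβ⟩ := key hΛ hb H2
  obtain ⟨β', hβZ', hβ'⟩ := key hΛ' hb' H2'
  let gt : V ≃ₗ[F] V := β.equiv β' (Equiv.refl _)
  have hgt : ∀ p, gt (β p) = β' p := fun p => β.equiv_apply p β' _
  refine ⟨gt, fun v => ?_, fun t v => ?_⟩
  · refine LinearMap.congr_fun (f := gt.toLinearMap * Z) (g := Z * gt.toLinearMap)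
      (β.ext fun p => ?_) v
    rw [Module.End.mul_apply, Module.End.mul_apply, LinearEquiv.coe_coe, hβZ, map_smul, hgt, hβZ']
  · conv_lhs => rw [← β.sum_repr v]
    conv_rhs => rw [← β.sum_repr v]
    simp only [map_sum, map_smul, hgt]
    rw [hβ, hβ']

end Conjugation

section Opposite

variable {D V : Type*} [DivisionRing D] [AddCommGroup V] [Module Dᵐᵒᵖ V] {ν : D → EReal} {d : ℕ}

theorem IsDiscreteVal.op (h : IsDiscreteVal ν d) :
    IsDiscreteVal (fun x : Dᵐᵒᵖ => ν x.unop) d where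
  e_pos := h.e_pos
  eq_top_iff := fun x => (h.eq_top_iff _).trans (MulOpposite.unop_eq_zero_iff x)
  map_mul := fun _ _ => (h.map_mul _ _).trans (add_comm _ _)
  min_le_add := fun _ _ => h.min_le_add _ _
  values := fun x hx => h.values _ ((MulOpposite.unop_ne_zero_iff x).2 hx)
  exists_uniformizer := h.exists_uniformizer.imp' MulOpposite.op fun _ hx => hx

theorem ValComplete.op (h : ValComplete ν) : ValComplete fun x : Dᵐᵒᵖ => ν x.unop := fun x hx =>
  (h (fun n => (x n).unop) hx).imp' MulOpposite.op fun _ hl => hl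

theorem IsLatticeFunction.zpow_smul_mem (h : IsDiscreteVal ν d) {Λ : ℝ → AddSubgroup V}
    (hΛ : IsLatticeFunction ν d Λ) {π : D} (hπ : ν π = (((d : ℝ)⁻¹ : ℝ) : EReal)) (m : ℤ) :
    ∀ (t : ℝ) (v : V), v ∈ Λ t → MulOpposite.op π ^ m • v ∈ Λ (t + m / d) := by
  have hπ0 : MulOpposite.op π ≠ 0 := (MulOpposite.op_ne_zero_iff _).2 (h.ne_zero_of_eq_coe hπ)
  induction m with
  | zero => intro t v hv; simpa using hv
  | succ m ih =>
    intro t v hv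
    have h1 := (hΛ.2.2.2 π hπ _ _).2 ⟨_, ih t v hv, rfl⟩
    rw [smul_smul, ← zpow_one_add₀ hπ0, add_comm 1] at h1
    convert h1 using 2
    push_cast
    ring
  | pred m ih =>
    intro t v hv
    have h1 := ih t v hv
    rw [← sub_add_cancel (t + _) (d : ℝ)⁻¹] at h1
    obtain ⟨w, hw, hwv⟩ := (hΛ.2.2.2 π hπ _ _).1 h1
    rw [sub_eq_neg_add, zpow_add₀ hπ0, mul_smul, hwv, smul_smul, zpow_neg_one,
      inv_mul_cancel₀ hπ0, one_smul]
    convert hw using 2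
    push_cast
    ring

/-- A lattice function is a filtration for the opposite valuation. -/
theorem IsLatticeFunction.isNormFiltration [Module.Finite Dᵐᵒᵖ V] (h : IsDiscreteVal ν d)
    {Λ : ℝ → AddSubgroup V} (hΛ : IsLatticeFunction ν d Λ) :
    IsNormFiltration (fun x : Dᵐᵒᵖ => ν x.unop) Λ := by
  have ho := h.op
  obtain ⟨π, hπ⟩ := h.exists_uniformizer
  have hπo := ho.zpow_eq_coe (x := MulOpposite.op π) hπ
  have hπ0 : MulOpposite.op π ≠ 0 := (MulOpposite.op_ne_zero_iff _).2 (h.ne_zero_of_eq_coe hπ)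
  have hsmul : ∀ (a t : ℝ) (c : Dᵐᵒᵖ) (v : V), (a : EReal) ≤ ν c.unop → v ∈ Λ t →
      c • v ∈ Λ (t + a) := by
    intro a t c v hc hv
    rcases eq_or_ne c 0 with rfl | hc0
    · rw [zero_smul]
      exact zero_mem _
    obtain ⟨m, hm⟩ := ho.values c hc0
    rw [hm, EReal.coe_le_coe_iff] at hc
    refine hΛ.2.1 _ (t + m / d) (by linarith) ?_
    have h1 : ν ((MulOpposite.op π ^ m)⁻¹ * c).unop = ((-(m * (d : ℝ)⁻¹) + m / d : ℝ) : EReal) :=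
      ho.mul_eq_coe (ho.map_inv (hπo m)) hm
    rw [div_eq_mul_inv, neg_add_cancel, EReal.coe_zero] at h1
    have h2 := hΛ.zpow_smul_mem h hπ m t _ ((hΛ.1 t).1 v hv _ h1.ge)
    rwa [MulOpposite.op_unop, smul_smul, mul_inv_cancel_left₀ (zpow_ne_zero _ hπ0)] at h2
  refine ⟨hΛ.2.1, fun t v hv => (hΛ.2.2.1 t v).2 hv, hsmul, fun v => ?_, fun v hv => ?_⟩
  · have hv : v ∈ Submodule.span Dᵐᵒᵖ (Λ 0 : Set V) := (hΛ.1 0).2.2 ▸ Submodule.mem_top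
    induction hv using Submodule.span_induction with
    | mem v hv => exact ⟨0, hv⟩
    | zero => exact ⟨0, zero_mem _⟩
    | add u v _ _ hu hv =>
      obtain ⟨a, ha⟩ := hu
      obtain ⟨b, hb⟩ := hv
      exact ⟨min a b, add_mem (hΛ.2.1 _ _ (min_le_left _ _) ha) (hΛ.2.1 _ _ (min_le_right _ _) hb)⟩
    | smul c v _ hv =>
      obtain ⟨a, ha⟩ := hv
      rcases eq_or_ne c 0 with rfl | hc0
      · exact ⟨0, by simp⟩
      · obtain ⟨m, hm⟩ := ho.values c hc0
        exact ⟨_, hsmul _ _ c v hm.ge ha⟩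
  · obtain ⟨s, -, hs⟩ := (hΛ.1 0).2.1
    let β := Module.finBasis Dᵐᵒᵖ V
    have hbd : ∀ c : Dᵐᵒᵖ, ∃ M : ℝ, (M : EReal) ≤ ν c.unop := fun c => by
      rcases eq_or_ne c 0 with rfl | hc0
      · exact ⟨0, by rw [ho.map_zero]; exact le_top⟩
      · obtain ⟨m, hm⟩ := ho.values c hc0
        exact ⟨_, hm.ge⟩
    choose M hM using hbd
    obtain ⟨M₀, hM₀⟩ := ((s ×ˢ Finset.univ).image fun p => M (β.repr p.1 p.2)).bddBelow
    have hcoord : ∀ i, ∀ v ∈ Λ 0, (M₀ : EReal) ≤ ν (β.repr v i).unop := by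
      intro i v hv
      have hle : AddSubgroup.closure
          {w : V | ∃ u ∈ s, ∃ y : D, 0 ≤ ν y ∧ w = MulOpposite.op y • u} ≤
          (ho.fil M₀).comap (β.coord i).toAddMonoidHom := by
        rw [AddSubgroup.closure_le]
        rintro _ ⟨u, hu, y, hy, rfl⟩
        change (M₀ : EReal) ≤ ν (β.repr (MulOpposite.op y • u) i).unop
        rw [map_smul, Finsupp.smul_apply, smul_eq_mul]
        have h1 : (M₀ : EReal) ≤ ν (β.repr u i).unop :=
          (EReal.coe_le_coe_iff.2 (hM₀ (Finset.mem_image.2 ⟨(u, i), by simpa using hu, rfl⟩))).trans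
            (hM _)
        have := ho.le_coe_mul (a := 0) (x := MulOpposite.op y) hy h1
        rwa [zero_add] at this
      exact hle (hs v hv)
    refine β.repr.map_eq_zero_iff.1 (Finsupp.ext fun i => ho.eq_zero_of_forall_le fun R => ?_)
    obtain ⟨n, hn⟩ := exists_nat_gt ((R - M₀) * d)
    have hd : (0 : ℝ) < d := by exact_mod_cast h.e_pos
    have hn' : R - M₀ < n / d := (lt_div_iff₀ hd).2 hn
    have h1 := hcoord i _ (by
      have := hΛ.zpow_smul_mem h hπ (-n) (n / d) v (hv _)
      rwa [Int.cast_neg, Int.cast_natCast, neg_div, add_neg_cancel] at this)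
    rw [map_smul, Finsupp.smul_apply, smul_eq_mul] at h1
    have h2 := ho.le_coe_mul (hπo n).ge h1
    rw [← mul_assoc, zpow_neg, mul_inv_cancel₀ (zpow_ne_zero _ hπ0), one_mul] at h2
    refine (EReal.coe_le_coe_iff.2 ?_).trans h2
    rw [Int.cast_natCast, ← div_eq_mul_inv]
    linarith

end Opposite

theorem exists_bezout_of_coprime_div_gcd {d e f m : ℕ} (hd : 0 < d) (hm : m ∣ f)
    (h : Nat.Coprime (d / Nat.gcd d e) f) : ∃ a b : ℤ, a * d + b * (m * e) = (e : ℤ) := by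
  obtain ⟨u, v, huv⟩ := Nat.isCoprime_iff_coprime.2 (h.coprime_dvd_right hm)
  obtain ⟨d', hd'⟩ := Nat.gcd_dvd_left d e
  obtain ⟨e', he'⟩ := Nat.gcd_dvd_right d e
  have hg : 0 < Nat.gcd d e := Nat.gcd_pos_of_pos_left e hd
  rw [Nat.div_eq_of_eq_mul_right hg hd'] at huv
  refine ⟨u * e', v, ?_⟩
  have h1 : (d : ℤ) = Nat.gcd d e * d' := by exact_mod_cast hd'
  have h2 : (e : ℤ) = Nat.gcd d e * e' := by exact_mod_cast he'
  linear_combination u * e' * h1 + (v * m - 1) * h2 + Nat.gcd d e * e' * huv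

/-- `k` a non-Archimedean local field, `D` a central division
`k`-algebra of index `d`, `V` a finite-dimensional right `D`-vector space, `E|k` a
field extension inside `End_D(V)` (given by the embedding `ι`), and `E_D` the
unramified intermediate field of `E|k` of degree `gcd(d, f(E|k))`.  Assume
`d/gcd(d, e(E|k))` is coprime to `f(E|k)`.  If the `o_D`-lattice functions `Λ`, `Λ′`,
each normalized by `E^×` up to translation, are conjugate under some `g ∈ Aut_D(V)`,
then they are conjugate under some `g̃ ∈ Aut_D(V)` centralizing `E_D`. -/
theorem stmt_14
    {k D V E : Type*} [Field k] [DivisionRing D] [Algebra k D]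
    [AddCommGroup V] [Module Dᵐᵒᵖ V] [Module k V]
    [IsScalarTower k Dᵐᵒᵖ V] [SMulCommClass Dᵐᵒᵖ k V] [Module.Finite Dᵐᵒᵖ V]
    [Field E] [Algebra k E] [FiniteDimensional k E]
    (νk : k → EReal) (νE : E → EReal) (νD : D → EReal) (e f q qE qD d : ℕ)
    (hk : IsLocalValuation k νk 1 q) (hE : IsLocalValuation E νE e qE)
    (hD : IsLocalValuation D νD d qD)
    (hcompatE : ∀ c : k, νE (algebraMap k E c) = νk c)
    (hcompatD : ∀ c : k, νD (algebraMap k D c) = νk c)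
    (hdeg : Module.finrank k E = e * f) (hresdeg : qE = q ^ f)
    (hdim : Module.finrank k D = d * d)
    (hcentral : ∀ z : D, (∀ w, z * w = w * z) → ∃ c : k, algebraMap k D c = z)
    -- the embedding of `E` into `End_D(V)`
    (ι : E →ₐ[k] Module.End Dᵐᵒᵖ V)
    -- `E_D`: the unramified intermediate field of degree `gcd(d, f(E|k))`
    (ED : IntermediateField k E)
    (hED_unr : ∀ x : ED, (x : E) ≠ 0 → ∃ m : ℤ, νE (x : E) = ((m : ℝ) : EReal))
    (hED_deg : Module.finrank k ED = Nat.gcd d f)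
    -- the coprimality assumption
    (hcop : Nat.Coprime (d / Nat.gcd d e) f)
    -- `Λ`, `Λ′` lattice functions, each normalized by `E^×` up to translation
    (Λ Λ' : ℝ → AddSubgroup V)
    (hΛ : IsLatticeFunction νD d Λ) (hΛ' : IsLatticeFunction νD d Λ')
    (hΛE : ∀ x : E, x ≠ 0 → ∃ s : ℝ, ∀ t : ℝ,
      ⇑(ι x) '' (Λ t : Set V) = (Λ (t - s) : Set V))
    (hΛ'E : ∀ x : E, x ≠ 0 → ∃ s : ℝ, ∀ t : ℝ,
      ⇑(ι x) '' (Λ' t : Set V) = (Λ' (t - s) : Set V))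
    -- `Λ` and `Λ′` are conjugate under `Aut_D(V)`
    (hconj : ∃ g : V ≃ₗ[Dᵐᵒᵖ] V, ∀ t : ℝ, ⇑g '' (Λ t : Set V) = (Λ' t : Set V)) :
    ∃ gt : V ≃ₗ[Dᵐᵒᵖ] V,
      (∀ (x : ED) (v : V), gt (ι (x : E) v) = ι (x : E) (gt v)) ∧
      ∀ t : ℝ, ⇑gt '' (Λ t : Set V) = (Λ' t : Set V) := by
  have hd : 0 < d := hD.e_pos
  have hq : 1 < q := hk.one_lt_q
  have hν := hD.isDiscreteVal.op
  have hcomp : ValComplete fun x : Dᵐᵒᵖ => νD x.unop := ValComplete.op hD.complete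
  have hcF : ∀ c : k, νD (algebraMap k Dᵐᵒᵖ c).unop = νk c := hcompatD
  have hcentral' : ∀ z : Dᵐᵒᵖ, (∀ w, Commute z w) → ∃ c : k, algebraMap k Dᵐᵒᵖ c = z := by
    intro z hz
    obtain ⟨c, hc⟩ := hcentral z.unop fun w =>
      congrArg MulOpposite.unop (hz (MulOpposite.op w)).eq.symm
    exact ⟨c, congrArg MulOpposite.op hc⟩
  have : Module.Finite k D := Module.finite_of_finrank_pos (by rw [hdim]; positivity)
  have : Module.Finite k Dᵐᵒᵖ := Module.Finite.equiv (MulOpposite.opLinearEquiv k)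
  obtain ⟨n, hn, hdn⟩ := exists_relIndex_fil_eq hk hν hcF
  rw [← (MulOpposite.opLinearEquiv k (M := D)).finrank_eq, hdim] at hdn
  obtain rfl : d = n := Nat.eq_of_mul_eq_mul_left hd hdn
  obtain ⟨ω, ϖ, s, hω⟩ := hν.exists_isTameFrame hcomp hn (by positivity)
  have hEν := hE.isDiscreteVal
  obtain ⟨ζ, hζ0, hζ1, hζ⟩ := exists_unramified_generator hk hEν hE.complete hcompatE ED hED_unr
  have hζ' := Subalgebra.toSubmodule_injective hζ
  have hdeg_ζ : (minpoly k ζ).natDegree = Nat.gcd d f := by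
    have h1 : IntermediateField.adjoin k {ζ} = ED := by
      apply IntermediateField.toSubalgebra_injective
      rw [hζ', IntermediateField.adjoin_simple_toSubalgebra_of_isAlgebraic
        (Algebra.IsAlgebraic.isAlgebraic ζ)]
    rw [← hED_deg, ← h1, IntermediateField.adjoin.finrank (Algebra.IsIntegral.isIntegral ζ)]
  have hab : ∃ a b : ℤ, a * d + b * ((minpoly k ζ).natDegree * e) = (e : ℤ) := by
    rw [hdeg_ζ]
    exact exists_bezout_of_coprime_div_gcd hd (Nat.gcd_dvd_right d f) hcop
  let ρ : E →+* Module.End Dᵐᵒᵖ V := ι.toRingHom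
  have hρ : ∀ (c : k) (v : V), ρ (algebraMap k E c) v = algebraMap k Dᵐᵒᵖ c • v := fun c v => by
    rw [algebraMap_smul]
    change ι (algebraMap k E c) v = c • v
    rw [ι.commutes, Module.algebraMap_end_apply]
  have hshift : ∀ {Λ : ℝ → AddSubgroup V},
      (∀ x : E, x ≠ 0 → ∃ s : ℝ, ∀ t : ℝ, ⇑(ι x) '' (Λ t : Set V) = (Λ (t - s) : Set V)) →
      ∀ x : E, x ≠ 0 → ∃ s, HasShift Λ (ρ x) s := by
    intro Λ h x hx
    obtain ⟨s, hs⟩ := h x hx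
    exact ⟨-s, HasShift.of_image_eq (B := ρ x⁻¹)
      (by rw [← map_mul, inv_mul_cancel₀ hx, map_one]) hs⟩
  have hZ : ∀ {Λ : ℝ → AddSubgroup V}, IsNormFiltration (fun x : Dᵐᵒᵖ => νD x.unop) Λ →
      (∀ x : E, x ≠ 0 → ∃ s, HasShift Λ (ρ x) s) → HasShift Λ (ρ ζ) 0 := fun h h' =>
    hasShift_of_val_eq hk hEν hcompatE hν hcF h ρ hρ h' (by rw [hζ0, EReal.coe_zero])
  have hZN : ρ ζ ^ (q ^ d - 1) = 1 := by
    rw [hED_deg] at hζ1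
    obtain ⟨a, ha⟩ := Nat.pow_sub_one_dvd_pow_sub_one q (Nat.gcd_dvd_left d f)
    rw [← map_pow, ha, pow_mul, hζ1, one_pow, map_one]
  have hF := hΛ.isNormFiltration hD.isDiscreteVal
  have hF' := hΛ'.isNormFiltration hD.isDiscreteVal
  have hS := hshift hΛE
  have hS' := hshift hΛ'E
  obtain ⟨g, hg⟩ := hconj
  obtain ⟨gt, hgtζ, hgt⟩ := exists_commuting_equiv hω hν hcomp hF hF' (hZ hF hS) (hZ hF' hS') hZN
    (fun t i j hi hj =>
      eigencount_eq hk hEν hcompatE hν hω hcF hcentral' hF ρ hρ hS hab hi hj t)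
    (fun t i j hi hj =>
      eigencount_eq hk hEν hcompatE hν hω hcF hcentral' hF' ρ hρ hS' hab hi hj t)
    g.toAddEquiv (fun t v => by
      change g v ∈ (Λ' t : Set V) ↔ v ∈ Λ t
      rw [← hg, g.injective.mem_set_image, SetLike.mem_coe])
  refine ⟨gt, fun x v => ?_, fun t => ?_⟩
  · have hx : (x : E) ∈ Algebra.adjoin k {ζ} := hζ' ▸ x.2
    generalize (x : E) = y at hx
    induction hx using Algebra.adjoin_induction generalizing v with
    | mem y hy =>
      rw [Set.mem_singleton_iff.1 hy]
      exact hgtζ v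
    | algebraMap c =>
      change gt (ρ _ v) = ρ _ (gt v)
      rw [hρ, hρ, map_smul]
    | add y z _ _ hy hz => rw [map_add, LinearMap.add_apply, map_add, hy, hz, LinearMap.add_apply]
    | mul y z _ _ hy hz => rw [map_mul, Module.End.mul_apply, hy, hz, Module.End.mul_apply]
  · ext w
    constructor
    · rintro ⟨v, hv, rfl⟩
      exact (hgt t v).2 hv
    · intro hw
      obtain ⟨v, rfl⟩ := gt.surjective w
      exact ⟨v, (hgt t v).1 hw, rfl⟩
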